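/- Let (f,ξ) be a classical solution of the Vlasov–Poisson system with point charge on [0,T] with M₀ = ∬ f₀ dx dv < 1 and with finite initial energy moments H_k(0) for all k < m₀. Let t ≤ min(1,T) and 3 < m < m₀. Let γ ∈ (0,1) satisfy γ < (m₀−m)/(m+3), and additionally γ ≤ (m−3)/(6−m) if m < 6; define k by k+3 = (m+3)(1+γ) and δ = γ/(1+(m+3)(γ+1)). Then ‖E(t)‖_{L^{m+3}(ℝ³)} ≤ C + C t^δ + C t^{1+γ+δ} H_m(t)^{3(k+3)/(m+3)²}, where C depends only on γ, m, m₀, 𝓗(0), M₀, (1−M₀)⁻¹, ‖f₀‖_{L∞}, ‖f₀‖_{L¹} and the initial moments H_k(0) for k < m₀ (and not on T). -/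

import Mathlib

open MeasureTheory Set Filter
open scoped ENNReal

noncomputable section

/-- Three-dimensional Euclidean space. -/
abbrev E3 : Type := EuclideanSpace ℝ (Fin 3)

/-- Spatial density `ρ(t,x) = ∫ f(t,x,v) dv`. -/
def rho (f : ℝ → E3 → E3 → ℝ) (t : ℝ) (x : E3) : ℝ := ∫ v : E3, f t x v

/-- Self-induced electric field `E(t,x) = ∫ (x-y)/|x-y|³ ρ(t,y) dy`. -/
def Efield (f : ℝ → E3 → E3 → ℝ) (t : ℝ) (x : E3) : E3 :=
  ∫ y : E3, (rho f t y / ‖x - y‖ ^ 3) • (x - y)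

/-- Singular field generated by the point charge located at `ξ t`:
`F(t,x) = (x-ξ(t))/|x-ξ(t)|³`. -/
def Fpt (ξ : ℝ → E3) (t : ℝ) (x : E3) : E3 := (‖x - ξ t‖ ^ 3)⁻¹ • (x - ξ t)

/-- Total mass `M(t) = ∬ f(t,x,v) dx dv`. -/
def mass (f : ℝ → E3 → E3 → ℝ) (t : ℝ) : ℝ := ∫ p : E3 × E3, f t p.1 p.2

/-- Total energy `𝓗(t)`. -/
def energy (f : ℝ → E3 → E3 → ℝ) (ξ η : ℝ → E3) (t : ℝ) : ℝ :=
    (1 / 2) * ∫ p : E3 × E3, ‖p.2‖ ^ 2 * f t p.1 p.2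
  + (1 / 2) * ‖η t‖ ^ 2
  + (1 / 2) * ∫ x : E3, ∫ y : E3, rho f t x * rho f t y / ‖x - y‖
  + ∫ x : E3, rho f t x / ‖x - ξ t‖

/-- `L^∞` norm of the initial datum `‖f₀‖_{L^∞}`. -/
def supf0 (f : ℝ → E3 → E3 → ℝ) : ℝ :=
  (eLpNorm (fun p : E3 × E3 => f 0 p.1 p.2) ⊤ volume).toReal

/-- A classical solution of the Vlasov–Poisson system with point charge on `[0,T]`:
`f` is a nonnegative `C¹` compactly supported density whose initial datum vanishes
in a neighborhood of the charge `ξ 0`, `ξ ∈ C²` with `ξ' = η`, `η' = E(t,ξ(t))`,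
and the Vlasov equation holds pointwise (away from the charge). -/
structure VPClassicalSolution (T : ℝ) where
  f : ℝ → E3 → E3 → ℝ
  ξ : ℝ → E3
  η : ℝ → E3
  T_pos : 0 < T
  f_nonneg : ∀ t x v, 0 ≤ f t x v
  f_c1 : ContDiff ℝ 1 (fun p : ℝ × E3 × E3 => f p.1 p.2.1 p.2.2)
  f_cpt : HasCompactSupport (fun p : ℝ × E3 × E3 => f p.1 p.2.1 p.2.2)
  f0_vanishes_near_charge : ∃ ε > 0, ∀ x v, ‖x - ξ 0‖ < ε → f 0 x v = 0
  ξ_c2 : ContDiff ℝ 2 ξ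
  ξ_ode : ∀ t, HasDerivAt ξ (η t) t
  η_ode : ∀ t ∈ Icc (0 : ℝ) T, HasDerivAt η (Efield f t (ξ t)) t
  vlasov : ∀ t ∈ Icc (0 : ℝ) T, ∀ x v, x ≠ ξ t →
      deriv (fun τ : ℝ => f τ x v) t
      + fderiv ℝ (fun y : E3 => f t y v) x v
      + fderiv ℝ (fun w : E3 => f t x w) v (Efield f t x + Fpt ξ t x) = 0

/-- The microscopic energy function
`h(t,x,v) = |v-η(t)|²/2 + 1/|x-ξ(t)| + 𝓗(0) + M₀⁻¹ + 1`. -/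
def hEnergy (f : ℝ → E3 → E3 → ℝ) (ξ η : ℝ → E3) (t : ℝ) (x v : E3) : ℝ :=
  ‖v - η t‖ ^ 2 / 2 + ‖x - ξ t‖⁻¹ + energy f ξ η 0 + (mass f 0)⁻¹ + 1

/-- The energy moment `H̃_k(t) = ∬ h(t,x,v)^{k/2} f(t,x,v) dx dv`. -/
def Htilde (f : ℝ → E3 → E3 → ℝ) (ξ η : ℝ → E3) (k t : ℝ) : ℝ :=
  ∫ p : E3 × E3, hEnergy f ξ η t p.1 p.2 ^ (k / 2) * f t p.1 p.2

/-- The running supremum of the energy moments `H_k(t) = sup_{0≤s≤t} H̃_k(s)`. -/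
def Hmom (f : ℝ → E3 → E3 → ℝ) (ξ η : ℝ → E3) (k t : ℝ) : ℝ :=
  sSup (Htilde f ξ η k '' Icc 0 t)

/-- Young's convolution inequality on `E3`, for nonnegative functions. -/
theorem lintegral_convolution_rpow_le {u K : E3 → ℝ≥0∞} (hu : Measurable u) (hK : Measurable K)
    {p s q : ℝ} (hp : 1 ≤ p) (hs : 1 ≤ s) (hpq : p ≤ q) (hsq : s ≤ q)
    (h : 1 / p + 1 / s = 1 + 1 / q) :
    (∫⁻ x, (∫⁻ y, u y * K (x - y)) ^ q) ^ (1 / q)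
      ≤ (∫⁻ y, u y ^ p) ^ (1 / p) * (∫⁻ z, K z ^ s) ^ (1 / s) := by
  have hp0 : 0 < p := by linarith
  have hs0 : 0 < s := by linarith
  have hq0 : 0 < q := by linarith
  have e1 : 0 ≤ 1 / q := by positivity
  have e2 : 0 ≤ 1 / p - 1 / q := sub_nonneg.2 (one_div_le_one_div_of_le hp0 hpq)
  have e3 : 0 ≤ 1 / s - 1 / q := sub_nonneg.2 (one_div_le_one_div_of_le hs0 hsq)
  set U := ∫⁻ y, u y ^ p with hU
  set Z := ∫⁻ z, K z ^ s with hZ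
  have hKx : ∀ x, Measurable fun y => K (x - y) := fun x => hK.comp (by fun_prop)
  have key : ∀ x, ∫⁻ y, u y * K (x - y) ≤
      (∫⁻ y, u y ^ p * K (x - y) ^ s) ^ (1 / q) * (U ^ (1 / p - 1 / q) * Z ^ (1 / s - 1 / q)) := by
    intro x
    have hz : ∫⁻ y, K (x - y) ^ s = Z := lintegral_sub_left_eq_self (fun z => K z ^ s) x
    have := ENNReal.lintegral_prod_norm_pow_le (μ := (volume : Measure E3)) Finset.univ
      (f := ![fun y => u y ^ p * K (x - y) ^ s, fun y => u y ^ p, fun y => K (x - y) ^ s])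
      (p := ![1 / q, 1 / p - 1 / q, 1 / s - 1 / q]) ?_ ?_ ?_
    · simp only [Fin.prod_univ_three, Matrix.cons_val_zero, Matrix.cons_val_one,
        Matrix.cons_val_two, Matrix.head_cons, Matrix.tail_cons] at this
      rw [hz] at this
      rw [← mul_assoc]
      refine le_trans (le_of_eq (lintegral_congr fun y => ?_)) this
      rw [ENNReal.mul_rpow_of_nonneg _ _ e1]
      have a1 : u y = (u y ^ p) ^ (1 / q) * (u y ^ p) ^ (1 / p - 1 / q) := by
        rw [← ENNReal.rpow_add_of_nonneg _ _ e1 e2, ← ENNReal.rpow_mul]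
        rw [show p * (1 / q + (1 / p - 1 / q)) = 1 by field_simp; ring, ENNReal.rpow_one]
      have a2 : K (x - y) = (K (x - y) ^ s) ^ (1 / q) * (K (x - y) ^ s) ^ (1 / s - 1 / q) := by
        rw [← ENNReal.rpow_add_of_nonneg _ _ e1 e3, ← ENNReal.rpow_mul]
        rw [show s * (1 / q + (1 / s - 1 / q)) = 1 by field_simp; ring, ENNReal.rpow_one]
      conv_lhs => rw [a1, a2]
      ring
    · intro i _
      fin_cases i
      · exact ((hu.pow_const p).mul ((hKx x).pow_const s)).aemeasurable
      · exact (hu.pow_const p).aemeasurable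
      · exact ((hKx x).pow_const s).aemeasurable
    · simp only [Fin.sum_univ_three, Matrix.cons_val_zero, Matrix.cons_val_one,
        Matrix.cons_val_two, Matrix.head_cons, Matrix.tail_cons]
      linarith
    · intro i _
      fin_cases i
      · exact e1
      · exact e2
      · exact e3
  have hK2 : Measurable fun z : E3 × E3 => K (z.1 - z.2) := hK.comp (by fun_prop)
  have hm : Measurable fun x => ∫⁻ y, u y ^ p * K (x - y) ^ s := by
    refine Measurable.lintegral_prod_right' (f := fun z : E3 × E3 => u z.2 ^ p * K (z.1 - z.2) ^ s)
        ?_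
    exact ((hu.comp measurable_snd).pow_const p).mul (hK2.pow_const s)
  have tot : ∫⁻ x, ∫⁻ y, u y ^ p * K (x - y) ^ s = U * Z := by
    rw [lintegral_lintegral_swap]
    · have : ∀ y, ∫⁻ x, u y ^ p * K (x - y) ^ s = u y ^ p * Z := by
        intro y
        have hy : Measurable fun x => K (x - y) := hK.comp (measurable_id.sub_const y)
        rw [lintegral_const_mul _ (hy.pow_const s)]
        rw [lintegral_sub_right_eq_self (fun z => K z ^ s) y]
      simp_rw [this]
      rw [lintegral_mul_const _ (hu.pow_const p)]
    · exact (((hu.comp measurable_snd).pow_const p).mul (hK2.pow_const s)).aemeasurable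
  calc (∫⁻ x, (∫⁻ y, u y * K (x - y)) ^ q) ^ (1 / q)
      ≤ (∫⁻ x, ((∫⁻ y, u y ^ p * K (x - y) ^ s) ^ (1 / q)
          * (U ^ (1 / p - 1 / q) * Z ^ (1 / s - 1 / q))) ^ q) ^ (1 / q) := by
        gcongr with x; exact key x
    _ = (∫⁻ x, (∫⁻ y, u y ^ p * K (x - y) ^ s)
          * (U ^ (1 / p - 1 / q) * Z ^ (1 / s - 1 / q)) ^ q) ^ (1 / q) := by
        congr 1
        refine lintegral_congr fun x => ?_
        rw [ENNReal.mul_rpow_of_nonneg _ _ hq0.le, ← ENNReal.rpow_mul,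
          one_div_mul_cancel hq0.ne', ENNReal.rpow_one]
    _ = U ^ (1 / p) * Z ^ (1 / s) := by
        rw [lintegral_mul_const _ hm, tot, ENNReal.mul_rpow_of_nonneg _ _ e1, ← ENNReal.rpow_mul,
          mul_one_div_cancel hq0.ne', ENNReal.rpow_one, ENNReal.mul_rpow_of_nonneg _ _ e1]
        rw [mul_mul_mul_comm, ← ENNReal.rpow_add_of_nonneg _ _ e1 e2,
          ← ENNReal.rpow_add_of_nonneg _ _ e1 e3]
        congr 2 <;> ring

/-- The modulus `|z|⁻²` of the Coulomb force. -/
def coulombKernel (z : E3) : ℝ≥0∞ := ENNReal.ofReal ((‖z‖ ^ 2)⁻¹)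

theorem measurable_coulombKernel : Measurable coulombKernel := by
  unfold coulombKernel; fun_prop

def coulombNear : E3 → ℝ≥0∞ := (Metric.ball 0 1).indicator coulombKernel

def coulombFar : E3 → ℝ≥0∞ := (Metric.ball 0 1)ᶜ.indicator coulombKernel

theorem measurable_coulombNear : Measurable coulombNear :=
  measurable_coulombKernel.indicator measurableSet_ball

theorem measurable_coulombFar : Measurable coulombFar :=
  measurable_coulombKernel.indicator measurableSet_ball.compl

theorem coulombNear_add_coulombFar (z : E3) : coulombNear z + coulombFar z = coulombKernel z := by
  unfold coulombNear coulombFar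
  exact congrFun (Set.indicator_self_add_compl _ _) z

theorem coulombFar_le_one (z : E3) : coulombFar z ≤ 1 := by
  unfold coulombFar
  by_cases h : z ∈ (Metric.ball (0 : E3) 1)ᶜ
  · rw [indicator_of_mem h]
    have : 1 ≤ ‖z‖ := by simpa using h
    unfold coulombKernel
    rw [← ENNReal.ofReal_one]
    exact ENNReal.ofReal_le_ofReal (inv_le_one_of_one_le₀ (one_le_pow₀ this))
  · rw [indicator_of_notMem h]; exact zero_le

theorem coulombNear_rpow_lintegral_ne_top {s : ℝ} (hs : 0 < s) (hs' : s < 3 / 2) :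
    ∫⁻ z, coulombNear z ^ s ≠ ⊤ := by
  have h1 : IntegrableOn (fun x : E3 => ((‖x‖ ^ 2)⁻¹) ^ s) (Metric.ball 0 1) := by
    rw [integrableOn_fun_norm_addHaar volume (f := fun r : ℝ => ((r ^ 2)⁻¹) ^ s)]
    have := (intervalIntegral.integrableOn_Ioo_rpow_iff (s := 2 - 2 * s) one_pos).2 (by linarith)
    refine this.congr_fun (fun y hy => ?_) measurableSet_Ioo
    have hy0 : 0 < y := hy.1
    simp only [finrank_euclideanSpace, Fintype.card_fin, smul_eq_mul]
    rw [show (3 - 1 : ℕ) = 2 from rfl, Real.inv_rpow (by positivity), ← Real.rpow_natCast y 2,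
      ← Real.rpow_mul hy0.le, ← Real.rpow_neg hy0.le, ← Real.rpow_add hy0]
    congr 1
  have h2 := h1.lintegral_lt_top
  refine ne_of_lt (lt_of_le_of_lt (le_of_eq ?_) h2)
  rw [← lintegral_indicator measurableSet_ball]
  refine lintegral_congr fun z => ?_
  unfold coulombNear coulombKernel
  by_cases hz : z ∈ Metric.ball (0 : E3) 1
  · rw [indicator_of_mem hz, indicator_of_mem hz, ENNReal.ofReal_rpow_of_nonneg (by positivity)
      hs.le]
  · rw [indicator_of_notMem hz, indicator_of_notMem hz, ENNReal.zero_rpow_of_pos hs]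

theorem coulombFar_rpow_lintegral_ne_top {s : ℝ} (hs : 3 / 2 < s) :
    ∫⁻ z, coulombFar z ^ s ≠ ⊤ := by
  have h1 := (integrable_one_add_norm (E := E3) (μ := volume) (r := 2 * s)
    (by simp; linarith)).const_mul ((2 : ℝ) ^ (2 * s))
  refine ne_of_lt (lt_of_le_of_lt (lintegral_mono fun z => ?_) h1.lintegral_lt_top)
  unfold coulombFar coulombKernel
  by_cases hz : z ∈ (Metric.ball (0 : E3) 1)ᶜ
  · have h1 : 1 ≤ ‖z‖ := by simpa using hz
    rw [indicator_of_mem hz, ENNReal.ofReal_rpow_of_nonneg (by positivity) (by linarith)]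
    refine ENNReal.ofReal_le_ofReal ?_
    rw [Real.rpow_neg (by positivity), Real.inv_rpow (by positivity), ← Real.rpow_natCast,
      ← Real.rpow_mul (by positivity), Nat.cast_ofNat]
    rw [← div_eq_mul_inv, inv_eq_one_div, div_le_div_iff₀ (by positivity) (by positivity), one_mul,
      ← Real.mul_rpow (by positivity) (by positivity)]
    gcongr
    linarith
  · rw [indicator_of_notMem hz, ENNReal.zero_rpow_of_pos (by linarith)]; exact zero_le

/-- Mapping property of the Coulomb force from `L¹ ∩ L^{q/3}` to `L^q`, `q > 6`. -/
theorem exists_coulomb_rpow_le {q : ℝ} (hq : 6 < q) : ∃ C : ℝ, 0 ≤ C ∧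
    ∀ u : E3 → ℝ≥0∞, Measurable u →
      (∫⁻ x, (∫⁻ y, u y * coulombKernel (x - y)) ^ q) ^ (1 / q)
        ≤ ENNReal.ofReal C * ((∫⁻ y, u y) + (∫⁻ y, u y ^ (q / 3)) ^ (3 / q)) := by
  have hs1 : 1 ≤ q / (q - 2) := by rw [le_div_iff₀ (by linarith)]; linarith
  have hs2 : q / (q - 2) < 3 / 2 := by rw [div_lt_div_iff₀ (by linarith) (by norm_num)]; linarith
  have hn := coulombNear_rpow_lintegral_ne_top (s := q / (q - 2)) (by linarith) hs2
  have hf := coulombFar_rpow_lintegral_ne_top (s := q) (by linarith)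
  set Cn := (∫⁻ z, coulombNear z ^ (q / (q - 2))) ^ (1 / (q / (q - 2))) with hCn
  set Cf := (∫⁻ z, coulombFar z ^ q) ^ (1 / q) with hCf
  have hCn' : Cn ≠ ⊤ := (ENNReal.rpow_lt_top_of_nonneg (by positivity) hn).ne
  have hCf' : Cf ≠ ⊤ := (ENNReal.rpow_lt_top_of_nonneg (by positivity) hf).ne
  refine ⟨(Cn + Cf).toReal, ENNReal.toReal_nonneg, fun u hu => ?_⟩
  rw [ENNReal.ofReal_toReal (ENNReal.add_ne_top.2 ⟨hCn', hCf'⟩)]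
  have mN : Measurable fun x => ∫⁻ y, u y * coulombNear (x - y) :=
    Measurable.lintegral_prod_right' (f := fun z : E3 × E3 => u z.2 * coulombNear (z.1 - z.2))
      ((hu.comp measurable_snd).mul (measurable_coulombNear.comp (by fun_prop)))
  have mF : Measurable fun x => ∫⁻ y, u y * coulombFar (x - y) :=
    Measurable.lintegral_prod_right' (f := fun z : E3 × E3 => u z.2 * coulombFar (z.1 - z.2))
      ((hu.comp measurable_snd).mul (measurable_coulombFar.comp (by fun_prop)))
  have split : ∀ x, ∫⁻ y, u y * coulombKernel (x - y)
      = ((fun x => ∫⁻ y, u y * coulombNear (x - y)) +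
          fun x => ∫⁻ y, u y * coulombFar (x - y)) x := by
    intro x
    simp only [Pi.add_apply]
    have hx : Measurable fun y => coulombNear (x - y) :=
      measurable_coulombNear.comp (measurable_const.sub measurable_id)
    rw [← lintegral_add_left (f := fun y => u y * coulombNear (x - y)) (hu.mul hx)]
    refine lintegral_congr fun y => ?_
    rw [← mul_add, coulombNear_add_coulombFar]
  simp_rw [split]
  refine (ENNReal.lintegral_Lp_add_le mN.aemeasurable mF.aemeasurable (by linarith)).trans ?_
  have b1 := lintegral_convolution_rpow_le hu measurable_coulombNear (p := q / 3)
    (s := q / (q - 2)) (q := q) (by linarith) hs1 (by linarith) (by linarith)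
    (by have : q - 2 ≠ 0 := by linarith
        field_simp; ring)
  have b2 := lintegral_convolution_rpow_le hu measurable_coulombFar (p := 1)
    (s := q) (q := q) le_rfl (by linarith) (by linarith) le_rfl (by simp)
  simp only [ENNReal.rpow_one, one_div_one, ← hCf, one_div_div] at b1 b2
  refine (add_le_add b1 b2).trans ?_
  rw [show (∫⁻ z, coulombNear z ^ (q / (q - 2))) ^ ((q - 2) / q) = Cn by rw [hCn, one_div_div]]
  rw [mul_add, add_mul, add_mul]
  rw [mul_comm _ Cn, mul_comm _ Cf]
  set X := ∫⁻ y, u y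
  set Y := (∫⁻ y, u y ^ (q / 3)) ^ (3 / q)
  calc Cn * Y + Cf * X ≤ (Cn * Y + Cf * X) + (Cn * X + Cf * Y) := le_self_add
    _ = _ := by ring

theorem exists_coulomb_sup_le : ∃ C : ℝ, 0 ≤ C ∧ ∀ (u : E3 → ℝ≥0∞) (R : ℝ≥0∞), Measurable u →
    (∀ y, u y ≤ R) → ∀ x, ∫⁻ y, u y * coulombKernel (x - y) ≤ ENNReal.ofReal C * R + ∫⁻ y, u y := by
  have hn := coulombNear_rpow_lintegral_ne_top (s := 1) (by norm_num) (by norm_num)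
  simp only [ENNReal.rpow_one] at hn
  refine ⟨(∫⁻ z, coulombNear z).toReal, ENNReal.toReal_nonneg, fun u R hu hR x => ?_⟩
  rw [ENNReal.ofReal_toReal hn]
  simp_rw [← coulombNear_add_coulombFar, mul_add]
  have hx : Measurable fun y => coulombNear (x - y) :=
    measurable_coulombNear.comp (measurable_const.sub measurable_id)
  rw [lintegral_add_left (f := fun y => u y * coulombNear (x - y)) (hu.mul hx)]
  refine add_le_add ?_ (lintegral_mono fun y => mul_le_of_le_one_right' (coulombFar_le_one _))
  calc ∫⁻ y, u y * coulombNear (x - y) ≤ ∫⁻ y, R * coulombNear (x - y) := by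
        gcongr with y; exact hR y
    _ = R * ∫⁻ z, coulombNear z := by
        rw [lintegral_const_mul _ hx,
          lintegral_sub_left_eq_self coulombNear x]
    _ = _ := mul_comm _ _

theorem integral_fderiv_apply_eq_zero {F : E3 → ℝ} (hF : ContDiff ℝ 1 F)
    (hc : HasCompactSupport F) (w : E3) : ∫ x, fderiv ℝ F x w = 0 := by
  have hi : Integrable fun x => fderiv ℝ F x w :=
    ((hF.continuous_fderiv one_ne_zero).clm_apply continuous_const).integrable_of_hasCompactSupport
      (hc.fderiv_apply (𝕜 := ℝ) w)
  have := integral_mul_fderiv_eq_neg_fderiv_mul_of_integrable (μ := (volume : Measure E3))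
    (f := fun _ => (1 : ℝ)) (g := F) (v := w) (by simp) (by simpa using hi)
    (by simpa using hF.continuous.integrable_of_hasCompactSupport hc)
    (fun x _ => differentiableAt_const _) (fun x _ => (hF.differentiable one_ne_zero) x)
  simpa using this

/-- The support of a restriction to a slice is compact. -/
theorem HasCompactSupport.comp_section {X Y Z : Type*} [TopologicalSpace X] [TopologicalSpace Y]
    [T2Space Y] [Zero Z] {g : X → Z} (hc : HasCompactSupport g) (i : Y → X) (r : X → Y)
    (hr : Continuous r) (hri : ∀ y, r (i y) = y) : HasCompactSupport fun y => g (i y) := by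
  refine HasCompactSupport.intro (hc.isCompact.image hr) fun y hy => ?_
  by_contra h
  exact hy ⟨i y, subset_tsupport _ h, hri y⟩

/-- Differentiation in time of the phase space integral of `g`, along the free transport
combined with an arbitrary velocity-independent force field `a`. -/
theorem hasDerivAt_integral_transport {g : ℝ × E3 × E3 → ℝ} (hg : ContDiff ℝ 1 g)
    (hc : HasCompactSupport g) (a : E3 → E3) (t : ℝ)
    (hint : Integrable fun p : E3 × E3 => fderiv ℝ g (t, p) (0, 0, a p.1)) :
    HasDerivAt (fun s => ∫ p : E3 × E3, g (s, p))
      (∫ p : E3 × E3, fderiv ℝ g (t, p) (1, p.2, a p.1)) t := by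
  have hd : Differentiable ℝ g := hg.differentiable one_ne_zero
  have hcf : Continuous (fderiv ℝ g) := hg.continuous_fderiv one_ne_zero
  have hsl : ∀ {Z : Type} [Zero Z] (G : ℝ × E3 × E3 → Z), HasCompactSupport G → ∀ s : ℝ,
      HasCompactSupport fun p : E3 × E3 => G (s, p) := fun G hG s =>
    hG.comp_section (fun p => (s, p)) Prod.snd continuous_snd fun _ => rfl
  have hcF : HasCompactSupport (fderiv ℝ g) := hc.fderiv (𝕜 := ℝ)
  obtain ⟨C, hC⟩ := hcF.exists_bound_of_continuous hcf
  have hderiv : HasDerivAt (fun s => ∫ p : E3 × E3, g (s, p))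
      (∫ p : E3 × E3, fderiv ℝ g (t, p) (1, 0, 0)) t := by
    refine (hasDerivAt_integral_of_dominated_loc_of_deriv_le (s := univ)
      (F' := fun s p => fderiv ℝ g (s, p) (1, 0, 0))
      (bound := (Prod.snd '' tsupport g).indicator fun _ => C * ‖((1, 0, 0) : ℝ × E3 × E3)‖)
      univ_mem ?_ ?_ ?_ ?_ ?_ ?_).2
    · exact Eventually.of_forall fun s => (hg.continuous.comp (by fun_prop)).aestronglyMeasurable
    · exact (hg.continuous.comp (by fun_prop)).integrable_of_hasCompactSupport (hsl g hc t)
    · exact ((hcf.comp (by fun_prop : Continuous fun p : E3 × E3 => (t, p))).clm_apply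
        continuous_const).aestronglyMeasurable
    · refine Eventually.of_forall fun p s _ => ?_
      by_cases hp : p ∈ Prod.snd '' tsupport g
      · rw [indicator_of_mem hp]
        exact (ContinuousLinearMap.le_opNorm _ _).trans (by gcongr; exact hC _)
      · rw [indicator_of_notMem hp]
        have : fderiv ℝ g (s, p) = 0 := by
          by_contra h
          exact hp ⟨(s, p), support_fderiv_subset ℝ h, rfl⟩
        simp [this]
    · have hK : IsCompact (Prod.snd '' tsupport g) := hc.isCompact.image continuous_snd
      exact (integrable_indicator_iff hK.measurableSet).2
        (integrableOn_const hK.measure_lt_top.ne)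
    · refine Eventually.of_forall fun p s _ => ?_
      have h1 : HasDerivAt (fun s : ℝ => (s, p)) (1, 0) s :=
        (hasDerivAt_id s).prodMk (hasDerivAt_const s p)
      exact (hd (s, p)).hasFDerivAt.comp_hasDerivAt s h1
  have cont_sl : Continuous fun p : E3 × E3 => fderiv ℝ g (t, p) :=
    hcf.comp (by fun_prop)
  have i1 : Integrable fun p : E3 × E3 => fderiv ℝ g (t, p) (1, 0, 0) := by
    refine (cont_sl.clm_apply continuous_const).integrable_of_hasCompactSupport ?_
    refine (hsl _ hcF t).mono' fun p hp => subset_tsupport _ fun h => hp ?_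
    simp only [] at h ⊢
    rw [h]; rfl
  have i2 : Integrable fun p : E3 × E3 => fderiv ℝ g (t, p) (0, p.2, 0) := by
    refine (cont_sl.clm_apply (by fun_prop)).integrable_of_hasCompactSupport ?_
    refine (hsl _ hcF t).mono' fun p hp => subset_tsupport _ fun h => hp ?_
    simp only [] at h ⊢
    rw [h]; rfl
  have z2 : ∫ p : E3 × E3, fderiv ℝ g (t, p) (0, p.2, 0) = 0 := by
    rw [Measure.volume_eq_prod, integral_prod_symm _ i2]
    refine integral_eq_zero_of_ae (Eventually.of_forall fun v => ?_)
    have hs : HasCompactSupport fun x => g (t, x, v) :=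
      hc.comp_section (fun x => (t, x, v)) (fun q => q.2.1) (by fun_prop) fun _ => rfl
    have hs' : ContDiff ℝ 1 fun x => g (t, x, v) := hg.comp (by fun_prop)
    refine Eq.trans (integral_congr_ae (Eventually.of_forall fun x => ?_))
      (integral_fderiv_apply_eq_zero hs' hs v)
    have h1 : HasFDerivAt (fun x : E3 => (t, x, v))
        ((0 : E3 →L[ℝ] ℝ).prod ((ContinuousLinearMap.id ℝ E3).prod 0)) x :=
      (hasFDerivAt_const t x).prodMk ((hasFDerivAt_id x).prodMk (hasFDerivAt_const v x))
    have h2 := ((hd (t, x, v)).hasFDerivAt.comp x h1).fderiv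
    simp only [Function.comp_def] at h2
    simp [h2]
  have z3 : ∫ p : E3 × E3, fderiv ℝ g (t, p) (0, 0, a p.1) = 0 := by
    rw [Measure.volume_eq_prod, integral_prod _ hint]
    refine integral_eq_zero_of_ae (Eventually.of_forall fun x => ?_)
    have hs : HasCompactSupport fun v => g (t, x, v) :=
      hc.comp_section (fun v => (t, x, v)) (fun q => q.2.2) (by fun_prop) fun _ => rfl
    have hs' : ContDiff ℝ 1 fun v => g (t, x, v) := hg.comp (by fun_prop)
    refine Eq.trans (integral_congr_ae (Eventually.of_forall fun v => ?_))
      (integral_fderiv_apply_eq_zero hs' hs (a x))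
    have h1 : HasFDerivAt (fun v : E3 => (t, x, v))
        ((0 : E3 →L[ℝ] ℝ).prod ((0 : E3 →L[ℝ] E3).prod (ContinuousLinearMap.id ℝ E3))) v :=
      (hasFDerivAt_const t v).prodMk ((hasFDerivAt_const x v).prodMk (hasFDerivAt_id v))
    have h2 := ((hd (t, x, v)).hasFDerivAt.comp v h1).fderiv
    simp only [Function.comp_def] at h2
    simp [h2]
  have tot : ∫ p : E3 × E3, fderiv ℝ g (t, p) (1, p.2, a p.1)
      = ∫ p : E3 × E3, fderiv ℝ g (t, p) (1, 0, 0) := by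
    have : ∀ p : E3 × E3, fderiv ℝ g (t, p) (1, p.2, a p.1) = fderiv ℝ g (t, p) (1, 0, 0)
        + fderiv ℝ g (t, p) (0, p.2, 0) + fderiv ℝ g (t, p) (0, 0, a p.1) := by
      intro p
      rw [← map_add, ← map_add]
      simp
    simp_rw [this]
    have i12 : Integrable fun p : E3 × E3 =>
        fderiv ℝ g (t, p) (1, 0, 0) + fderiv ℝ g (t, p) (0, p.2, 0) := i1.add i2
    rw [integral_add i12 hint, integral_add i1 i2, z2, z3, add_zero, add_zero]
  rw [tot]
  exact hderiv

namespace VPClassicalSolution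

variable {T : ℝ} (S : VPClassicalSolution T)

/-- The density as a function on `ℝ × E3 × E3`. -/
def dens (q : ℝ × E3 × E3) : ℝ := S.f q.1 q.2.1 q.2.2

/-- The total force field `E + F`. -/
def force (t : ℝ) (x : E3) : E3 := Efield S.f t x + Fpt S.ξ t x

theorem dens_contDiff : ContDiff ℝ 1 S.dens := S.f_c1

theorem dens_hasCompactSupport : HasCompactSupport S.dens := S.f_cpt

theorem dens_nonneg (q : ℝ × E3 × E3) : 0 ≤ S.dens q := S.f_nonneg _ _ _

theorem fderiv_dens {t : ℝ} (ht : t ∈ Icc 0 T) {x : E3} (v : E3) (hx : x ≠ S.ξ t) :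
    fderiv ℝ S.dens (t, x, v) (1, v, S.force t x) = 0 := by
  have hd := (S.dens_contDiff.differentiable one_ne_zero (t, x, v)).hasFDerivAt
  have h1 : HasDerivAt (fun τ : ℝ => (τ, x, v)) (1, 0) t :=
    (hasDerivAt_id t).prodMk (hasDerivAt_const t (x, v))
  have h2 : HasFDerivAt (fun x : E3 => (t, x, v))
      ((0 : E3 →L[ℝ] ℝ).prod ((ContinuousLinearMap.id ℝ E3).prod 0)) x :=
    (hasFDerivAt_const t x).prodMk ((hasFDerivAt_id x).prodMk (hasFDerivAt_const v x))
  have h3 : HasFDerivAt (fun v : E3 => (t, x, v))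
      ((0 : E3 →L[ℝ] ℝ).prod ((0 : E3 →L[ℝ] E3).prod (ContinuousLinearMap.id ℝ E3))) v :=
    (hasFDerivAt_const t v).prodMk ((hasFDerivAt_const x v).prodMk (hasFDerivAt_id v))
  have e1 := (hd.comp_hasDerivAt t h1).deriv
  have e2 := (hd.comp x h2).fderiv
  have e3 := (hd.comp v h3).fderiv
  have hV := S.vlasov t ht x v hx
  change deriv (S.dens ∘ fun τ : ℝ => (τ, x, v)) t
      + fderiv ℝ (S.dens ∘ fun y : E3 => (t, y, v)) x v
      + fderiv ℝ (S.dens ∘ fun w : E3 => (t, x, w)) v (S.force t x) = 0 at hV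
  rw [e1, e2, e3] at hV
  simp only [ContinuousLinearMap.comp_apply, ContinuousLinearMap.prod_apply,
    zero_apply, ContinuousLinearMap.id_apply] at hV
  rw [← map_add, ← map_add] at hV
  simpa using hV

theorem continuous_f (t : ℝ) : Continuous fun p : E3 × E3 => S.f t p.1 p.2 :=
  S.dens_contDiff.continuous.comp (by fun_prop : Continuous fun p : E3 × E3 => (t, p))

theorem hasCompactSupport_f (t : ℝ) : HasCompactSupport fun p : E3 × E3 => S.f t p.1 p.2 :=
  S.dens_hasCompactSupport.comp_section (fun p : E3 × E3 => (t, p)) Prod.snd continuous_snd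
    fun _ => rfl

theorem integrable_f (t : ℝ) : Integrable fun p : E3 × E3 => S.f t p.1 p.2 :=
  (S.continuous_f t).integrable_of_hasCompactSupport (S.hasCompactSupport_f t)

theorem continuous_f_right (t : ℝ) (x : E3) : Continuous fun v => S.f t x v :=
  (S.continuous_f t).comp (by fun_prop : Continuous fun v : E3 => (x, v))

theorem hasCompactSupport_f_right (t : ℝ) (x : E3) : HasCompactSupport fun v => S.f t x v :=
  (S.hasCompactSupport_f t).comp_section (fun v : E3 => (x, v)) Prod.snd continuous_snd
    fun _ => rfl

theorem integrable_f_right (t : ℝ) (x : E3) : Integrable fun v => S.f t x v :=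
  (S.continuous_f_right t x).integrable_of_hasCompactSupport (S.hasCompactSupport_f_right t x)

theorem exists_velocity_bound : ∃ R : ℝ, 0 ≤ R ∧ ∀ t x v, S.f t x v ≠ 0 → ‖v‖ ≤ R := by
  obtain ⟨R, hR⟩ := (S.dens_hasCompactSupport.isCompact.image
    (continuous_snd.comp continuous_snd)).isBounded.exists_norm_le
  refine ⟨max R 0, le_max_right _ _, fun t x v h => le_max_of_le_left (hR v ?_)⟩
  exact ⟨(t, x, v), subset_tsupport _ h, rfl⟩

theorem rho_nonneg (t : ℝ) (x : E3) : 0 ≤ rho S.f t x :=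
  integral_nonneg fun v => S.f_nonneg t x v

theorem measurable_rho (t : ℝ) : Measurable (rho S.f t) :=
  (StronglyMeasurable.integral_prod_right' (S.continuous_f t).stronglyMeasurable).measurable

theorem ofReal_rho (t : ℝ) (x : E3) :
    ENNReal.ofReal (rho S.f t x) = ∫⁻ v, ENNReal.ofReal (S.f t x v) :=
  ofReal_integral_eq_lintegral_ofReal (S.integrable_f_right t x)
    (Eventually.of_forall fun v => S.f_nonneg t x v)

theorem exists_rho_bound : ∃ R : ℝ, ∀ t x, rho S.f t x ≤ R := by
  obtain ⟨C, hC⟩ := S.dens_hasCompactSupport.exists_bound_of_continuous S.dens_contDiff.continuous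
  obtain ⟨R, -, hR⟩ := S.exists_velocity_bound
  refine ⟨∫ v : E3, (Metric.closedBall (0 : E3) R).indicator (fun _ => C) v, fun t x => ?_⟩
  refine integral_mono (S.integrable_f_right t x) ?_ fun v => ?_
  · exact (integrable_indicator_iff measurableSet_closedBall).2
      (integrableOn_const measure_closedBall_lt_top.ne)
  · by_cases hv : v ∈ Metric.closedBall (0 : E3) R
    · rw [indicator_of_mem hv]
      exact (le_abs_self _).trans (hC (t, x, v))
    · rw [indicator_of_notMem hv]
      refine le_of_eq ?_
      by_contra h
      exact hv (by simpa using hR t x v h)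

theorem lintegral_rho (t : ℝ) : ∫⁻ x, ENNReal.ofReal (rho S.f t x) =
    ENNReal.ofReal (mass S.f t) := by
  rw [mass, ofReal_integral_eq_lintegral_ofReal (S.integrable_f t)
    (Eventually.of_forall fun p => S.f_nonneg t p.1 p.2), Measure.volume_eq_prod,
    lintegral_prod _ (S.continuous_f t).measurable.ennreal_ofReal.aemeasurable]
  exact lintegral_congr fun x => S.ofReal_rho t x

theorem enorm_coulomb (r : ℝ) (hr : 0 ≤ r) (z : E3) :
    ‖(r / ‖z‖ ^ 3) • z‖ₑ = ENNReal.ofReal r * coulombKernel z := by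
  rw [coulombKernel, ← ENNReal.ofReal_mul hr, ← ofReal_norm]
  congr 1
  rw [norm_smul, Real.norm_of_nonneg (by positivity)]
  rcases eq_or_ne z 0 with rfl | hz
  · simp
  · have : ‖z‖ ≠ 0 := norm_ne_zero_iff.2 hz
    field_simp

theorem enorm_Efield_le (t : ℝ) (x : E3) :
    ‖Efield S.f t x‖ₑ ≤ ∫⁻ y, ENNReal.ofReal (rho S.f t y) * coulombKernel (x - y) := by
  refine (enorm_integral_le_lintegral_enorm _).trans (le_of_eq (lintegral_congr fun y => ?_))
  exact enorm_coulomb _ (S.rho_nonneg t y) _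

theorem measurable_Efield (t : ℝ) : Measurable (Efield S.f t) := by
  refine (StronglyMeasurable.integral_prod_right' (f := fun z : E3 × E3 =>
    (rho S.f t z.2 / ‖z.1 - z.2‖ ^ 3) • (z.1 - z.2)) ?_).measurable
  refine Measurable.stronglyMeasurable ?_
  have hr : Measurable fun z : E3 × E3 => rho S.f t z.2 := (S.measurable_rho t).comp measurable_snd
  fun_prop

theorem measurable_force (t : ℝ) : Measurable (S.force t) := by
  unfold force Fpt
  have := S.measurable_Efield t
  fun_prop

theorem exists_mass_bound : ∃ C : ℝ, ∀ t, mass S.f t ≤ C := by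
  obtain ⟨C, hC⟩ := S.dens_hasCompactSupport.exists_bound_of_continuous S.dens_contDiff.continuous
  have hK : IsCompact (Prod.snd '' tsupport S.dens) :=
    S.dens_hasCompactSupport.isCompact.image continuous_snd
  refine ⟨∫ p : E3 × E3, (Prod.snd '' tsupport S.dens).indicator (fun _ => C) p, fun t => ?_⟩
  refine integral_mono (S.integrable_f t) ?_ fun p => ?_
  · exact (integrable_indicator_iff hK.measurableSet).2 (integrableOn_const hK.measure_lt_top.ne)
  · by_cases hp : p ∈ Prod.snd '' tsupport S.dens
    · rw [indicator_of_mem hp]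
      exact (le_abs_self _).trans (hC (t, p))
    · rw [indicator_of_notMem hp]
      refine le_of_eq ?_
      by_contra h
      exact hp ⟨(t, p), subset_tsupport _ h, rfl⟩

theorem exists_Efield_bound : ∃ C : ℝ, 0 ≤ C ∧ ∀ t x, ‖Efield S.f t x‖ ≤ C := by
  obtain ⟨C, hC, h⟩ := exists_coulomb_sup_le
  obtain ⟨R, hR⟩ := S.exists_rho_bound
  obtain ⟨M, hM⟩ := S.exists_mass_bound
  refine ⟨C * |R| + |M|, by positivity, fun t x => ?_⟩
  have := (S.enorm_Efield_le t x).trans (h _ (ENNReal.ofReal |R|)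
    (S.measurable_rho t).ennreal_ofReal
    (fun y => ENNReal.ofReal_le_ofReal ((hR t y).trans (le_abs_self R))) x)
  rw [S.lintegral_rho, ← ENNReal.ofReal_mul hC] at this
  have h2 := this.trans (add_le_add_right
    (ENNReal.ofReal_le_ofReal ((hM t).trans (le_abs_self M))) _)
  rw [← ENNReal.ofReal_add (by positivity) (by positivity), ← ofReal_norm] at h2
  exact (ENNReal.ofReal_le_ofReal_iff (by positivity)).1 h2

theorem ae_ne_charge (t : ℝ) : ∀ᵐ p : E3 × E3, p.1 ≠ S.ξ t := by
  rw [ae_iff]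
  have : {p : E3 × E3 | ¬ p.1 ≠ S.ξ t} = {S.ξ t} ×ˢ (univ : Set E3) := by
    ext p; simp
  rw [this, Measure.volume_eq_prod, Measure.prod_prod]
  simp

theorem hasDerivAt_integral_of_fderiv_eq {g : ℝ × E3 × E3 → ℝ} (hg : ContDiff ℝ 1 g)
    (hc : HasCompactSupport g) {t : ℝ} {D b : E3 × E3 → ℝ}
    (hD : ∀ x v, x ≠ S.ξ t → fderiv ℝ g (t, x, v) (1, v, S.force t x) = D (x, v))
    (hb : Integrable b) (hDb : ∀ p, |D p| ≤ b p) :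
    Integrable D ∧ HasDerivAt (fun s => ∫ p : E3 × E3, g (s, p)) (∫ p, D p) t := by
  have hcf : Continuous fun p : E3 × E3 => fderiv ℝ g (t, p) :=
    (hg.continuous_fderiv one_ne_zero).comp (by fun_prop)
  have hae : (fun p : E3 × E3 => fderiv ℝ g (t, p) (1, p.2, S.force t p.1)) =ᵐ[volume] D := by
    filter_upwards [S.ae_ne_charge t] with p hp
    exact hD p.1 p.2 hp
  have hmeas : AEStronglyMeasurable (fun p : E3 × E3 =>
      fderiv ℝ g (t, p) (1, p.2, S.force t p.1)) volume := by
    have hf : Measurable fun p : E3 × E3 => S.force t p.1 :=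
      (S.measurable_force t).comp measurable_fst
    have hv : Measurable fun p : E3 × E3 => ((1 : ℝ), p.2, S.force t p.1) := by fun_prop
    have ha : Continuous fun z : (ℝ × E3 × E3 →L[ℝ] ℝ) × (ℝ × E3 × E3) => z.1 z.2 := by fun_prop
    exact (ha.measurable.comp (hcf.measurable.prodMk hv)).aestronglyMeasurable
  have hDi : Integrable D := hb.mono' (hmeas.congr hae) (Eventually.of_forall hDb)
  refine ⟨hDi, ?_⟩
  have i1 : Integrable fun p : E3 × E3 => fderiv ℝ g (t, p) (1, p.2, 0) := by
    refine (hcf.clm_apply (by fun_prop)).integrable_of_hasCompactSupport ?_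
    have := (hc.fderiv (𝕜 := ℝ)).comp_section (fun p : E3 × E3 => (t, p)) Prod.snd continuous_snd
      fun _ => rfl
    refine this.mono' fun p hp => subset_tsupport _ fun h => hp ?_
    simp only [] at h ⊢
    rw [h]; rfl
  have key := hasDerivAt_integral_transport hg hc (S.force t) t ?_
  · rwa [integral_congr_ae hae] at key
  · refine ((hDi.congr hae.symm).sub i1).congr (Eventually.of_forall fun p => ?_)
    simp only [Pi.sub_apply]
    rw [← map_sub]
    simp

theorem fderiv_eq_of_hasDerivAt {φ : ℝ × E3 × E3 → ℝ} {t : ℝ} {x v a : E3} {d : ℝ}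
    (hφ : DifferentiableAt ℝ φ (t, x, v))
    (h : HasDerivAt (fun s : ℝ => φ (t + s, x + s • v, v + s • a)) d 0) :
    fderiv ℝ φ (t, x, v) (1, v, a) = d := by
  have hc : HasDerivAt (fun s : ℝ => (t + s, x + s • v, v + s • a)) (1, v, a) 0 := by
    refine HasDerivAt.prodMk ?_ (HasDerivAt.prodMk ?_ ?_)
    · simpa using (hasDerivAt_id (0 : ℝ)).const_add t
    · simpa using ((hasDerivAt_id (0 : ℝ)).smul_const v).const_add x
    · simpa using ((hasDerivAt_id (0 : ℝ)).smul_const a).const_add v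
  have hφ' : HasFDerivAt φ (fderiv ℝ φ (t, x, v))
      (t + (0 : ℝ), x + (0 : ℝ) • v, v + (0 : ℝ) • a) := by
    simpa using hφ.hasFDerivAt
  exact (hφ'.comp_hasDerivAt (0 : ℝ) hc).unique h

/-- Quantities transported by the flow have constant integral. -/
theorem integral_comp_dens_eq {Φ : ℝ → ℝ} (hΦ : ContDiff ℝ 1 Φ) (hΦ0 : Φ 0 = 0) {t : ℝ}
    (ht : t ∈ Icc 0 T) :
    ∫ p : E3 × E3, Φ (S.dens (t, p)) = ∫ p : E3 × E3, Φ (S.dens (0, p)) := by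
  have hd : ∀ s ∈ Icc 0 T, HasDerivAt (fun s => ∫ p : E3 × E3, (Φ ∘ S.dens) (s, p)) 0 s := by
    intro s hs
    have := (S.hasDerivAt_integral_of_fderiv_eq (g := Φ ∘ S.dens) (hΦ.comp S.dens_contDiff)
      (S.dens_hasCompactSupport.comp_left hΦ0) (t := s) (D := 0) (b := 0) ?_ ?_ ?_).2
    · simpa using this
    · intro x v hx
      rw [fderiv_comp _ (hΦ.differentiable one_ne_zero _)
          (S.dens_contDiff.differentiable one_ne_zero _)]
      simp [S.fderiv_dens hs v hx]
    · exact integrable_zero _ _ _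
    · intro p; simp
  exact constant_of_has_deriv_right_zero
    (fun s hs => (hd s hs).continuousAt.continuousWithinAt)
    (fun s hs => (hd s (Ico_subset_Icc_self hs)).hasDerivWithinAt) t ht

theorem mass_eq {t : ℝ} (ht : t ∈ Icc 0 T) : mass S.f t = mass S.f 0 :=
  S.integral_comp_dens_eq (Φ := id) contDiff_id rfl ht

theorem f_le_supf0 {t : ℝ} (ht : t ∈ Icc 0 T) (x v : E3) : S.f t x v ≤ supf0 S.f := by
  set A := supf0 S.f with hA
  have hA0 : 0 ≤ A := ENNReal.toReal_nonneg
  have hΦ : ContDiff ℝ 1 fun r : ℝ => Real.smoothTransition (r - A) :=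
    Real.smoothTransition.contDiff.comp (by fun_prop)
  have hΦ0 : Real.smoothTransition (0 - A) = 0 := Real.smoothTransition.zero_of_nonpos (by linarith)
  have h := S.integral_comp_dens_eq hΦ hΦ0 ht
  have h0 : ∫ p : E3 × E3, Real.smoothTransition (S.dens (0, p) - A) = 0 := by
    refine integral_eq_zero_of_ae ?_
    obtain ⟨C, hC⟩ := (S.hasCompactSupport_f 0).exists_bound_of_continuous (S.continuous_f 0)
    have hfin : eLpNorm (fun p : E3 × E3 => S.f 0 p.1 p.2) ⊤ volume ≠ ⊤ :=
      (memLp_top_of_bound (S.continuous_f 0).aestronglyMeasurable C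
        (Eventually.of_forall hC)).2.ne
    have hae := ae_le_eLpNormEssSup (f := fun p : E3 × E3 => S.f 0 p.1 p.2) (μ := volume)
    filter_upwards [hae] with p hp
    refine Real.smoothTransition.zero_of_nonpos (sub_nonpos.2 ?_)
    rw [← eLpNorm_exponent_top] at hp
    have := (ENNReal.toReal_le_toReal (by simp) hfin).2 hp
    rw [toReal_enorm] at this
    exact (le_abs_self _).trans this
  rw [h0] at h
  have hcont : Continuous fun p : E3 × E3 => Real.smoothTransition (S.dens (t, p) - A) :=
    hΦ.continuous.comp (S.continuous_f t)
  have hcs : HasCompactSupport fun p : E3 × E3 => Real.smoothTransition (S.dens (t, p) - A) :=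
    (S.hasCompactSupport_f t).comp_left (g := fun r : ℝ => Real.smoothTransition (r - A)) hΦ0
  have h1 := (integral_eq_zero_iff_of_nonneg (fun p => Real.smoothTransition.nonneg _)
    (hcont.integrable_of_hasCompactSupport hcs)).1 h
  have h2 := (Continuous.ae_eq_iff_eq volume hcont continuous_zero).1 h1
  have h3 := congrFun h2 (x, v)
  exact sub_nonpos.1 (Real.smoothTransition.zero_iff_nonpos.1 h3)

end VPClassicalSolution

theorem hasDerivAt_norm_of_ne_zero {w : ℝ → E3} {w' : E3} {s : ℝ} (h : HasDerivAt w w' s)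
    (h0 : w s ≠ 0) : HasDerivAt (fun s => ‖w s‖) (inner ℝ (w s) w' / ‖w s‖) s := by
  have h1 := h.norm_sq.sqrt (by simpa using h0)
  simp only [Real.sqrt_sq (norm_nonneg _)] at h1
  convert h1 using 1
  rw [mul_div_mul_left _ _ two_ne_zero]

theorem exists_abs_deriv_smoothTransition_le :
    ∃ C : ℝ, ∀ r, |deriv Real.smoothTransition r| ≤ C := by
  have hc : ContDiff ℝ 1 Real.smoothTransition := Real.smoothTransition.contDiff
  refine HasCompactSupport.exists_bound_of_continuous (f := deriv Real.smoothTransition) ?_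
    (hc.continuous_deriv le_rfl)
  refine HasCompactSupport.intro (isCompact_Icc (a := (0 : ℝ)) (b := 1)) fun x hx => ?_
  rw [mem_Icc, not_and_or, not_le, not_le] at hx
  rcases hx with hx | hx
  · have : Real.smoothTransition =ᶠ[nhds x] fun _ => 0 := by
      filter_upwards [Iio_mem_nhds hx] with y hy
      exact Real.smoothTransition.zero_of_nonpos (le_of_lt hy)
    rw [this.deriv_eq, deriv_const]
  · have : Real.smoothTransition =ᶠ[nhds x] fun _ => 1 := by
      filter_upwards [Ioi_mem_nhds hx] with y hy
      exact Real.smoothTransition.one_of_one_le (le_of_lt hy)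
    rw [this.deriv_eq, deriv_const]

namespace VPClassicalSolution

variable {T : ℝ} (S : VPClassicalSolution T)

theorem contDiff_η : ContDiff ℝ 1 S.η := by
  have h : S.η = deriv S.ξ := funext fun t => (S.ξ_ode t).deriv.symm
  rw [h]
  exact ((contDiff_succ_iff_deriv (n := 1)).1 S.ξ_c2).2.2

theorem contDiff_ξ : ContDiff ℝ 1 S.ξ := S.ξ_c2.of_le (by norm_num)

/-- The energy of a particle relative to the charge, without the additive constants. -/
def chargeEnergy (q : ℝ × E3 × E3) : ℝ := ‖q.2.2 - S.η q.1‖ ^ 2 / 2 + ‖q.2.1 - S.ξ q.1‖⁻¹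

theorem chargeEnergy_nonneg (q : ℝ × E3 × E3) : 0 ≤ S.chargeEnergy q := by
  unfold chargeEnergy; positivity

theorem contDiff_sub_ξ : ContDiff ℝ 1 fun q : ℝ × E3 × E3 => q.2.1 - S.ξ q.1 :=
  contDiff_snd.fst.sub (S.contDiff_ξ.comp contDiff_fst)

theorem contDiff_sub_η : ContDiff ℝ 1 fun q : ℝ × E3 × E3 => q.2.2 - S.η q.1 :=
  contDiff_snd.snd.sub (S.contDiff_η.comp contDiff_fst)

theorem contDiffAt_chargeEnergy {q : ℝ × E3 × E3} (hq : q.2.1 ≠ S.ξ q.1) :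
    ContDiffAt ℝ 1 S.chargeEnergy q := by
  refine ContDiffAt.add ?_ ?_
  · exact (S.contDiff_sub_η.norm_sq ℝ).contDiffAt.div_const 2
  · exact (S.contDiff_sub_ξ.contDiffAt.norm ℝ (sub_ne_zero.2 hq)).inv
      (norm_ne_zero_iff.2 (sub_ne_zero.2 hq))

theorem hasDerivAt_sub_η {t : ℝ} (ht : t ∈ Icc 0 T) (v a : E3) :
    HasDerivAt (fun s : ℝ => v + s • a - S.η (t + s)) (a - Efield S.f t (S.ξ t)) 0 := by
  refine HasDerivAt.sub ?_ ?_
  · simpa using ((hasDerivAt_id (0 : ℝ)).smul_const a).const_add v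
  · exact HasDerivAt.comp_const_add t 0 (by simpa using S.η_ode t ht)

theorem hasDerivAt_sub_ξ (t : ℝ) (x v : E3) :
    HasDerivAt (fun s : ℝ => x + s • v - S.ξ (t + s)) (v - S.η t) 0 := by
  refine HasDerivAt.sub ?_ ?_
  · simpa using ((hasDerivAt_id (0 : ℝ)).smul_const v).const_add x
  · exact HasDerivAt.comp_const_add t 0 (by simpa using S.ξ_ode t)

theorem hasDerivAt_chargeEnergy {t : ℝ} (ht : t ∈ Icc 0 T) {x : E3} (v : E3) (hx : x ≠ S.ξ t) :
    HasDerivAt (fun s : ℝ => S.chargeEnergy (t + s, x + s • v, v + s • S.force t x))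
      (inner ℝ (v - S.η t) (Efield S.f t x - Efield S.f t (S.ξ t))) 0 := by
  have h1 := ((S.hasDerivAt_sub_η ht v (S.force t x)).norm_sq).div_const 2
  have h2 := (hasDerivAt_norm_of_ne_zero (S.hasDerivAt_sub_ξ t x v)
    (by simpa using sub_ne_zero.2 hx)).inv (by simpa using sub_ne_zero.2 hx)
  have hr : ‖x - S.ξ t‖ ≠ 0 := norm_ne_zero_iff.2 (sub_ne_zero.2 hx)
  refine (h1.add h2).congr_deriv ?_
  simp only [zero_smul, add_zero, force, Fpt, inner_sub_right, inner_add_right, inner_smul_right]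
  have hs := real_inner_comm (x - S.ξ t) (v - S.η t)
  rw [inner_sub_right, inner_sub_right] at hs
  rw [hs]
  field_simp
  ring

theorem exists_η_bound : ∃ N : ℝ, 0 ≤ N ∧ ∀ t ∈ Icc 0 T, ‖S.η t‖ ≤ N := by
  obtain ⟨N, hN⟩ := (isCompact_Icc (a := (0 : ℝ)) (b := T)).exists_bound_of_continuousOn
    S.contDiff_η.continuous.continuousOn
  exact ⟨max N 0, le_max_right _ _, fun t ht => le_max_of_le_left (hN t ht)⟩

/-- The density keeps a positive distance from the charge. -/
theorem exists_vanishing_radius :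
    ∃ δ : ℝ, 0 < δ ∧ ∀ t ∈ Icc 0 T, ∀ x v, ‖x - S.ξ t‖ < δ → S.f t x v = 0 := by
  obtain ⟨ε, hε, hε0⟩ := S.f0_vanishes_near_charge
  obtain ⟨R, hR0, hR⟩ := S.exists_velocity_bound
  obtain ⟨N, hN0, hN⟩ := S.exists_η_bound
  obtain ⟨CE, hCE0, hCE⟩ := S.exists_Efield_bound
  obtain ⟨C1, hC1⟩ := exists_abs_deriv_smoothTransition_le
  have hC10 : 0 ≤ C1 := (abs_nonneg _).trans (hC1 0)
  set L := (R + N) * (2 * CE) with hL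
  have hL0 : 0 ≤ L := by positivity
  set B := (R + N) ^ 2 / 2 + ε⁻¹ with hB
  have hB0 : 0 ≤ B := by positivity
  have hT := S.T_pos
  have hsc : ContDiff ℝ 1 Real.smoothTransition := Real.smoothTransition.contDiff
  classical
  set φ : ℝ × E3 × E3 → ℝ := fun q =>
    if q.2.1 = S.ξ q.1 then 1 else Real.smoothTransition (S.chargeEnergy q - L * q.1 - B) with hφ
  have hopen : ∀ q : ℝ × E3 × E3, q.2.1 ≠ S.ξ q.1 → ∀ᶠ q' in nhds q, q'.2.1 ≠ S.ξ q'.1 :=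
    fun q hq => (continuous_snd.fst.continuousAt.prodMk
      (S.contDiff_ξ.continuous.comp continuous_fst).continuousAt).eventually
      (isOpen_ne_fun continuous_fst continuous_snd |>.mem_nhds hq)
  have hφe : ∀ q : ℝ × E3 × E3, q.2.1 ≠ S.ξ q.1 →
      φ =ᶠ[nhds q] fun q => Real.smoothTransition (S.chargeEnergy q - L * q.1 - B) := by
    intro q hq
    filter_upwards [hopen q hq] with q' hq'
    simp only [hφ, if_neg hq']
  have hφd : ContDiff ℝ 1 φ := by
    rw [contDiff_iff_contDiffAt]
    intro q
    by_cases hq : q.2.1 = S.ξ q.1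
    · have : φ =ᶠ[nhds q] fun _ => 1 := by
        have hcont : Continuous fun q' : ℝ × E3 × E3 =>
            ‖q'.2.1 - S.ξ q'.1‖ * (L * |q'.1| + B + 1) :=
          S.contDiff_sub_ξ.continuous.norm.mul (by fun_prop)
        have hlt : ∀ᶠ q' in nhds q, ‖q'.2.1 - S.ξ q'.1‖ * (L * |q'.1| + B + 1) < 1 :=
          hcont.continuousAt.eventually (Iio_mem_nhds (by simp [hq]))
        filter_upwards [hlt] with q' hq'
        by_cases h : q'.2.1 = S.ξ q'.1
        · simp [hφ, h]
        · simp only [hφ, if_neg h]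
          refine Real.smoothTransition.one_of_one_le ?_
          have hr : 0 < ‖q'.2.1 - S.ξ q'.1‖ := norm_pos_iff.2 (sub_ne_zero.2 h)
          have h1 : L * |q'.1| + B + 1 ≤ ‖q'.2.1 - S.ξ q'.1‖⁻¹ := by
            rw [← one_div, le_div_iff₀ hr, mul_comm]; exact hq'.le
          have h2 : L * q'.1 ≤ L * |q'.1| := mul_le_mul_of_nonneg_left (le_abs_self _) hL0
          have h3 : ‖q'.2.1 - S.ξ q'.1‖⁻¹ ≤ S.chargeEnergy q' := by
            unfold chargeEnergy
            have : 0 ≤ ‖q'.2.2 - S.η q'.1‖ ^ 2 / 2 := by positivity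
            linarith
          linarith
      exact contDiffAt_const.congr_of_eventuallyEq this
    · refine ContDiffAt.congr_of_eventuallyEq ?_ (hφe q hq)
      refine hsc.contDiffAt.comp q ?_
      exact ((S.contDiffAt_chargeEnergy hq).sub (by fun_prop)).sub contDiffAt_const
  have hφ0 : ∀ q, 0 ≤ φ q := by
    intro q
    simp only [hφ]
    split_ifs
    · exact zero_le_one
    · exact Real.smoothTransition.nonneg _
  have hgd : ContDiff ℝ 1 (fun q => φ q * S.dens q) := hφd.mul S.dens_contDiff
  have hgc : HasCompactSupport (fun q => φ q * S.dens q) := S.dens_hasCompactSupport.mul_left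
  set D : ℝ → E3 × E3 → ℝ := fun t p =>
    deriv Real.smoothTransition (S.chargeEnergy (t, p) - L * t - B) *
      (inner ℝ (p.2 - S.η t) (Efield S.f t p.1 - Efield S.f t (S.ξ t)) - L) *
          S.f t p.1 p.2 with hDdef
  have hin : ∀ t ∈ Icc 0 T, ∀ p : E3 × E3, S.f t p.1 p.2 ≠ 0 →
      |inner ℝ (p.2 - S.η t) (Efield S.f t p.1 - Efield S.f t (S.ξ t))| ≤ L := by
    intro t ht p hp
    refine (abs_real_inner_le_norm _ _).trans ?_
    refine mul_le_mul ?_ ?_ (norm_nonneg _) (by positivity)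
    · exact (norm_sub_le _ _).trans (add_le_add (hR t _ _ hp) (hN t ht))
    · exact (norm_sub_le _ _).trans (by linarith [hCE t p.1, hCE t (S.ξ t)])
  have hder : ∀ t ∈ Icc 0 T,
      HasDerivAt (fun s => ∫ p : E3 × E3, φ (s, p) * S.dens (s, p)) (∫ p, D t p) t := by
    intro t ht
    refine (S.hasDerivAt_integral_of_fderiv_eq hgd hgc (D := D t)
      (b := fun p => C1 * (L + L) * S.f t p.1 p.2) ?_ ((S.integrable_f t).const_mul _) ?_).2
    · intro x v hx
      have hφ' : fderiv ℝ φ (t, x, v) (1, v, S.force t x) =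
          deriv Real.smoothTransition (S.chargeEnergy (t, x, v) - L * t - B) *
            (inner ℝ (v - S.η t) (Efield S.f t x - Efield S.f t (S.ξ t)) - L) := by
        rw [(hφe (t, x, v) hx).fderiv_eq]
        refine fderiv_eq_of_hasDerivAt ?_ ?_
        · exact (hsc.contDiffAt.comp (t, x, v) (((S.contDiffAt_chargeEnergy (q := (t, x, v)) hx).sub
            (by fun_prop)).sub contDiffAt_const)).differentiableAt one_ne_zero
        · have h1 : HasDerivAt (fun s : ℝ => L * (t + s)) L 0 := by
            simpa using ((hasDerivAt_id (0 : ℝ)).const_add t).const_mul L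
          have h2 := ((S.hasDerivAt_chargeEnergy ht v hx).sub h1).sub_const B
          refine HasDerivAt.comp (0 : ℝ) (h₂ := Real.smoothTransition) ?_ h2
          simpa using (hsc.differentiable one_ne_zero _).hasDerivAt
      have h3 := fderiv_mul (hφd.differentiable one_ne_zero (t, x, v))
        (S.dens_contDiff.differentiable one_ne_zero (t, x, v))
      rw [show (fun q => φ q * S.dens q) = φ * S.dens from rfl, h3]
      simp only [add_apply, smul_apply, S.fderiv_dens ht v hx, hφ', smul_eq_mul, mul_zero, zero_add,
        hDdef]
      rw [mul_comm]; rfl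
    · intro p
      simp only [hDdef, abs_mul, abs_of_nonneg (S.f_nonneg t p.1 p.2)]
      by_cases hp : S.f t p.1 p.2 = 0
      · simp [hp]
      · refine mul_le_mul_of_nonneg_right ?_ (S.f_nonneg _ _ _)
        refine mul_le_mul (hC1 _) ?_ (abs_nonneg _) hC10
        refine (abs_sub _ _).trans ?_
        rw [abs_of_nonneg hL0]
        linarith [hin t ht p hp]
  have hanti : AntitoneOn (fun s => ∫ p : E3 × E3, φ (s, p) * S.dens (s, p)) (Icc 0 T) := by
    refine antitoneOn_of_hasDerivWithinAt_nonpos (convex_Icc 0 T)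
      (fun t ht => (hder t ht).continuousAt.continuousWithinAt)
      (fun t ht => (hder t (interior_subset ht)).hasDerivWithinAt) fun t ht => ?_
    refine integral_nonpos fun p => ?_
    simp only [hDdef, Pi.zero_apply]
    by_cases hp : S.f t p.1 p.2 = 0
    · simp [hp]
    · refine mul_nonpos_of_nonpos_of_nonneg ?_ (S.f_nonneg _ _ _)
      refine mul_nonpos_of_nonneg_of_nonpos (Real.smoothTransition.monotone.deriv_nonneg) ?_
      linarith [(abs_le.1 (hin t (interior_subset ht) p hp)).2]
  refine ⟨(B + L * T + 1)⁻¹, by positivity, fun t ht x v hxv => ?_⟩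
  by_contra hf
  have h0 : ∫ p : E3 × E3, φ (0, p) * S.dens (0, p) = 0 := by
    refine integral_eq_zero_of_ae (Eventually.of_forall fun p => ?_)
    by_cases hp : S.f 0 p.1 p.2 = 0
    · simp [dens, hp]
    · have hr : ε ≤ ‖p.1 - S.ξ 0‖ := not_lt.1 fun h => hp (hε0 _ _ h)
      have hne : p.1 ≠ S.ξ 0 := fun h => by simp [h] at hr; linarith
      have : φ (0, p) = 0 := by
        simp only [hφ, if_neg hne]
        refine Real.smoothTransition.zero_of_nonpos ?_
        have h1 : ‖p.2 - S.η 0‖ ≤ R + N := (norm_sub_le _ _).trans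
          (add_le_add (hR 0 _ _ hp) (hN 0 ⟨le_rfl, hT.le⟩))
        have h2 : ‖p.1 - S.ξ 0‖⁻¹ ≤ ε⁻¹ := inv_anti₀ hε hr
        have h3 : ‖p.2 - S.η 0‖ ^ 2 ≤ (R + N) ^ 2 := pow_le_pow_left₀ (norm_nonneg _) h1 2
        simp only [chargeEnergy, hB]
        linarith
      simp [this]
  have h1 : ∫ p : E3 × E3, φ (t, p) * S.dens (t, p) = 0 := by
    refine le_antisymm ?_ (integral_nonneg fun p => mul_nonneg (hφ0 _) (S.dens_nonneg _))
    have := hanti ⟨le_rfl, hT.le⟩ ht ht.1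
    simp only [h0] at this
    exact this
  have hcont : Continuous fun p : E3 × E3 => φ (t, p) * S.dens (t, p) :=
    hgd.continuous.comp (by fun_prop : Continuous fun p : E3 × E3 => (t, p))
  have hcs : HasCompactSupport fun p : E3 × E3 => φ (t, p) * S.dens (t, p) :=
    hgc.comp_section (fun p : E3 × E3 => (t, p)) Prod.snd continuous_snd fun _ => rfl
  have h2 := (integral_eq_zero_iff_of_nonneg (fun p => mul_nonneg (hφ0 _) (S.dens_nonneg _))
    (hcont.integrable_of_hasCompactSupport hcs)).1 h1
  have h3 := congrFun ((Continuous.ae_eq_iff_eq volume hcont continuous_zero).1 h2) (x, v)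
  have h4 : φ (t, x, v) = 0 := by
    rcases mul_eq_zero.1 h3 with h | h
    · exact h
    · exact absurd h hf
  by_cases hx : x = S.ξ t
  · simp [hφ, hx] at h4
  · simp only [hφ, if_neg hx] at h4
    have h5 := Real.smoothTransition.zero_iff_nonpos.1 h4
    have hr : 0 < ‖x - S.ξ t‖ := norm_pos_iff.2 (sub_ne_zero.2 hx)
    have h6 : B + L * T + 1 < ‖x - S.ξ t‖⁻¹ := by
      rw [lt_inv_comm₀ (by positivity) hr]; exact hxv
    have h7 : L * t ≤ L * T := mul_le_mul_of_nonneg_left ht.2 hL0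
    have h8 : 0 ≤ ‖v - S.η t‖ ^ 2 / 2 := by positivity
    simp only [chargeEnergy] at h5
    linarith

end VPClassicalSolution

namespace VPClassicalSolution

variable {T : ℝ} (S : VPClassicalSolution T)

theorem norm_Fpt (t : ℝ) (x : E3) : ‖Fpt S.ξ t x‖ = (‖x - S.ξ t‖ ^ 2)⁻¹ := by
  rw [Fpt, norm_smul, norm_inv, norm_pow, norm_norm]
  rcases eq_or_ne (‖x - S.ξ t‖) 0 with h | h
  · simp [h]
  · field_simp

/-- A weight which is continuous off the charge, times the density, is continuous. -/
theorem continuous_smul_f {V : Type*} [NormedAddCommGroup V] [NormedSpace ℝ V] {t : ℝ}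
    (ht : t ∈ Icc 0 T) {ψ : E3 × E3 → V} (hψ : ∀ p : E3 × E3, p.1 ≠ S.ξ t → ContinuousAt ψ p) :
    Continuous fun p : E3 × E3 => S.f t p.1 p.2 • ψ p := by
  obtain ⟨δ, hδ, h0⟩ := S.exists_vanishing_radius
  rw [continuous_iff_continuousAt]
  intro p
  by_cases hp : p.1 = S.ξ t
  · have : (fun p : E3 × E3 => S.f t p.1 p.2 • ψ p) =ᶠ[nhds p] fun _ => 0 := by
      have hc : Continuous fun p' : E3 × E3 => ‖p'.1 - S.ξ t‖ := by fun_prop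
      filter_upwards [hc.continuousAt.eventually (Iio_mem_nhds (by simpa [hp] using hδ))]
          with p' hp'
      rw [h0 t ht _ _ hp', zero_smul]
    exact continuousAt_const.congr this.symm
  · exact (S.continuous_f t).continuousAt.smul (hψ p hp)

theorem integrable_smul_f {V : Type*} [NormedAddCommGroup V] [NormedSpace ℝ V] {t : ℝ}
    (ht : t ∈ Icc 0 T) {ψ : E3 × E3 → V} (hψ : ∀ p : E3 × E3, p.1 ≠ S.ξ t → ContinuousAt ψ p) :
    Integrable fun p : E3 × E3 => S.f t p.1 p.2 • ψ p :=
  (S.continuous_smul_f ht hψ).integrable_of_hasCompactSupport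
    ((S.hasCompactSupport_f t).smul_right (f' := ψ))

theorem integrable_mul_f {t : ℝ} (ht : t ∈ Icc 0 T) {ψ : E3 × E3 → ℝ}
    (hψ : ∀ p : E3 × E3, p.1 ≠ S.ξ t → ContinuousAt ψ p) :
    Integrable fun p : E3 × E3 => ψ p * S.f t p.1 p.2 := by
  simpa only [smul_eq_mul, mul_comm] using S.integrable_smul_f ht hψ

/-- Time derivative of a moment of the density whose weight is smooth off the charge. -/
theorem hasDerivWithinAt_moment {φ : ℝ × E3 × E3 → ℝ}
    (hφ : ∀ q : ℝ × E3 × E3, q.2.1 ≠ S.ξ q.1 → ContDiffAt ℝ 1 φ q) {t : ℝ} (ht : t ∈ Icc 0 T)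
    {φ' : E3 × E3 → ℝ} (hφ' : ∀ x v, x ≠ S.ξ t →
      HasDerivAt (fun s : ℝ => φ (t + s, x + s • v, v + s • S.force t x)) (φ' (x, v)) 0) :
    Integrable (fun p : E3 × E3 => φ' p * S.f t p.1 p.2) ∧
    HasDerivWithinAt (fun s => ∫ p : E3 × E3, φ (s, p) * S.f s p.1 p.2)
      (∫ p : E3 × E3, φ' p * S.f t p.1 p.2) (Icc 0 T) t := by
  obtain ⟨δ, hδ, h0⟩ := S.exists_vanishing_radius
  obtain ⟨R, hR0, hR⟩ := S.exists_velocity_bound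
  obtain ⟨CE, hCE0, hCE⟩ := S.exists_Efield_bound
  have hr : ∀ s ∈ Icc 0 T, ∀ p : E3 × E3, S.f s p.1 p.2 ≠ 0 → δ ≤ ‖p.1 - S.ξ s‖ :=
    fun s hs p hp => not_lt.1 fun h => hp (h0 s hs _ _ h)
  have hsc : ContDiff ℝ 1 Real.smoothTransition := Real.smoothTransition.contDiff
  set a : ℝ × E3 × E3 → ℝ := fun q => 4 / δ ^ 2 * ‖q.2.1 - S.ξ q.1‖ ^ 2 - 1 with ha
  have had : ContDiff ℝ 1 a := (contDiff_const.mul (S.contDiff_sub_ξ.norm_sq ℝ)).sub contDiff_const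
  set φt : ℝ × E3 × E3 → ℝ := fun q => Real.smoothTransition (a q) * φ q with hφt
  have hone : ∀ q : ℝ × E3 × E3, δ ≤ ‖q.2.1 - S.ξ q.1‖ → 1 < a q := by
    intro q hq
    have : δ ^ 2 ≤ ‖q.2.1 - S.ξ q.1‖ ^ 2 := pow_le_pow_left₀ hδ.le hq 2
    have h2 : 4 / δ ^ 2 * δ ^ 2 ≤ 4 / δ ^ 2 * ‖q.2.1 - S.ξ q.1‖ ^ 2 :=
      mul_le_mul_of_nonneg_left this (by positivity)
    rw [div_mul_cancel₀ _ (by positivity)] at h2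
    simp only [ha]
    linarith
  have hφtd : ContDiff ℝ 1 φt := by
    rw [contDiff_iff_contDiffAt]
    intro q
    by_cases hq : q.2.1 = S.ξ q.1
    · have : φt =ᶠ[nhds q] fun _ => 0 := by
        filter_upwards [had.continuous.continuousAt.eventually
          (Iio_mem_nhds (show a q < 0 by simp [ha, hq]))] with q' hq'
        simp only [hφt, Real.smoothTransition.zero_of_nonpos (le_of_lt hq'), zero_mul]
      exact contDiffAt_const.congr_of_eventuallyEq this
    · exact ((hsc.comp had).contDiffAt).mul (hφ q hq)
  have heq : ∀ q : ℝ × E3 × E3, δ ≤ ‖q.2.1 - S.ξ q.1‖ → φt =ᶠ[nhds q] φ := by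
    intro q hq
    filter_upwards [had.continuous.continuousAt.eventually (Ioi_mem_nhds (hone q hq))] with q' hq'
    simp only [hφt, Real.smoothTransition.one_of_one_le (le_of_lt hq'), one_mul]
  have hfd : ∀ p : E3 × E3, S.f t p.1 p.2 ≠ 0 →
      fderiv ℝ φt (t, p) (1, p.2, S.force t p.1) = φ' p := by
    intro p hp
    have hrp := hr t ht p hp
    have hne : p.1 ≠ S.ξ t := fun h => by simp [h] at hrp; linarith
    rw [(heq (t, p) hrp).fderiv_eq]
    exact fderiv_eq_of_hasDerivAt ((hφ (t, p) hne).differentiableAt one_ne_zero)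
      (hφ' p.1 p.2 hne)
  have hgd : ContDiff ℝ 1 (φt * S.dens) := hφtd.mul S.dens_contDiff
  have hgc : HasCompactSupport (φt * S.dens) := S.dens_hasCompactSupport.mul_left
  have hcfd : Continuous fun p : E3 × E3 => ‖fderiv ℝ φt (t, p)‖ :=
    ((hφtd.continuous_fderiv one_ne_zero).comp
      (by fun_prop : Continuous fun p : E3 × E3 => (t, p))).norm
  have key : Integrable (fun p : E3 × E3 => φ' p * S.f t p.1 p.2) ∧
      HasDerivAt (fun s => ∫ p : E3 × E3, (φt * S.dens) (s, p))
        (∫ p : E3 × E3, φ' p * S.f t p.1 p.2) t := by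
    refine S.hasDerivAt_integral_of_fderiv_eq hgd hgc
      (b := fun p => ‖fderiv ℝ φt (t, p)‖ * (1 + R + CE + (δ ^ 2)⁻¹) * S.f t p.1 p.2) ?_ ?_ ?_
    · intro x v hx
      rw [fderiv_mul (hφtd.differentiable one_ne_zero (t, x, v))
        (S.dens_contDiff.differentiable one_ne_zero (t, x, v))]
      simp only [add_apply, smul_apply, S.fderiv_dens ht v hx, smul_eq_mul, mul_zero, zero_add]
      by_cases hp : S.f t x v = 0
      · simp [hp, dens]
      · rw [hfd (x, v) hp, mul_comm]; rfl
    · exact ((hcfd.mul continuous_const).mul (S.continuous_f t)).integrable_of_hasCompactSupport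
        (S.hasCompactSupport_f t).mul_left
    · intro p
      by_cases hp : S.f t p.1 p.2 = 0
      · simp [hp]
      · rw [abs_mul, abs_of_nonneg (S.f_nonneg t p.1 p.2)]
        refine mul_le_mul_of_nonneg_right ?_ (S.f_nonneg _ _ _)
        rw [← hfd p hp, ← Real.norm_eq_abs]
        refine ((fderiv ℝ φt (t, p)).le_opNorm _).trans
          (mul_le_mul_of_nonneg_left ?_ (norm_nonneg _))
        have hrp := hr t ht p hp
        have hF : ‖S.force t p.1‖ ≤ CE + (δ ^ 2)⁻¹ := by
          refine (norm_add_le _ _).trans (add_le_add (hCE t p.1) ?_)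
          rw [S.norm_Fpt]
          exact inv_anti₀ (by positivity) (pow_le_pow_left₀ hδ.le hrp 2)
        have hv := hR t _ _ hp
        have hδ2 : 0 ≤ (δ ^ 2)⁻¹ := by positivity
        rw [Prod.norm_def, Prod.norm_def]
        refine max_le ?_ (max_le ?_ ?_)
        · simp only [norm_one]; linarith
        · simp only []; linarith
        · simp only []; linarith
  refine ⟨key.1, key.2.hasDerivWithinAt.congr_of_mem (fun s hs => ?_) ht⟩
  refine integral_congr_ae (Eventually.of_forall fun p => ?_)
  by_cases hp : S.f s p.1 p.2 = 0
  · simp [hp, dens]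
  · have := (heq (s, p) (hr s hs p hp)).eq_of_nhds
    simp only [Pi.mul_apply, this, dens]

end VPClassicalSolution

namespace VPClassicalSolution

variable {T : ℝ} (S : VPClassicalSolution T)

theorem mass_nonneg (t : ℝ) : 0 ≤ mass S.f t := integral_nonneg fun _ => S.f_nonneg _ _ _

theorem energy_nonneg (t : ℝ) : 0 ≤ energy S.f S.ξ S.η t := by
  have hρ := S.rho_nonneg t
  unfold energy
  refine mul_nonneg (by norm_num) (integral_nonneg fun p => ?_)
  refine add_nonneg (add_nonneg (mul_nonneg (by positivity) (S.f_nonneg _ _ _)) (by positivity))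
    (mul_nonneg (by norm_num) (integral_nonneg fun x => integral_nonneg fun y => ?_))
  exact add_nonneg (div_nonneg (mul_nonneg (hρ x) (hρ y)) (norm_nonneg _))
    (integral_nonneg fun x => div_nonneg (hρ x) (norm_nonneg _))

/-- The additive constant of the energy function. -/
def energyShift : ℝ := energy S.f S.ξ S.η 0 + (mass S.f 0)⁻¹ + 1

theorem one_le_energyShift : 1 ≤ S.energyShift := by
  have h1 := S.energy_nonneg 0
  have h2 := inv_nonneg.2 (S.mass_nonneg 0)
  unfold energyShift
  linarith

theorem hEnergy_eq (t : ℝ) (x v : E3) :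
    hEnergy S.f S.ξ S.η t x v = S.chargeEnergy (t, x, v) + S.energyShift := by
  simp only [hEnergy, chargeEnergy, energyShift]
  ring

theorem one_le_hEnergy (t : ℝ) (x v : E3) : 1 ≤ hEnergy S.f S.ξ S.η t x v := by
  rw [S.hEnergy_eq]
  linarith [S.one_le_energyShift, S.chargeEnergy_nonneg (t, x, v)]

theorem norm_sub_η_le (t : ℝ) (x v : E3) :
    ‖v - S.η t‖ ≤ √2 * hEnergy S.f S.ξ S.η t x v ^ (1 / 2 : ℝ) := by
  rw [← Real.sqrt_eq_rpow, ← Real.sqrt_mul zero_le_two]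
  refine Real.le_sqrt_of_sq_le ?_
  have h1 := S.one_le_energyShift
  have h2 : 0 ≤ ‖x - S.ξ t‖⁻¹ := by positivity
  rw [S.hEnergy_eq, chargeEnergy]
  linarith

theorem contDiffAt_hEnergy_rpow (a : ℝ) {q : ℝ × E3 × E3} (hq : q.2.1 ≠ S.ξ q.1) :
    ContDiffAt ℝ 1 (fun q : ℝ × E3 × E3 => hEnergy S.f S.ξ S.η q.1 q.2.1 q.2.2 ^ a) q := by
  simp only [S.hEnergy_eq]
  refine ((S.contDiffAt_chargeEnergy hq).add contDiffAt_const).rpow_const_of_ne ?_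
  rw [← S.hEnergy_eq]
  linarith [S.one_le_hEnergy q.1 q.2.1 q.2.2]

theorem continuousAt_section {φ : ℝ × E3 × E3 → ℝ} {t : ℝ} {p : E3 × E3}
    (h : ContDiffAt ℝ 1 φ (t, p)) : ContinuousAt (fun p => φ (t, p)) p :=
  ContinuousAt.comp (g := φ) h.continuousAt
    (by fun_prop : Continuous fun p : E3 × E3 => (t, p)).continuousAt

theorem continuousAt_hEnergy_rpow (a : ℝ) {t : ℝ} {p : E3 × E3} (hp : p.1 ≠ S.ξ t) :
    ContinuousAt (fun p : E3 × E3 => hEnergy S.f S.ξ S.η t p.1 p.2 ^ a) p :=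
  continuousAt_section (S.contDiffAt_hEnergy_rpow a (q := (t, p)) hp)

theorem integrable_mul_Efield {t : ℝ} (ht : t ∈ Icc 0 T) {ψ : E3 × E3 → ℝ}
    (hψ : ∀ p : E3 × E3, p.1 ≠ S.ξ t → ContinuousAt ψ p) :
    Integrable fun p : E3 × E3 => ψ p * ‖Efield S.f t p.1‖ * S.f t p.1 p.2 := by
  obtain ⟨C, hC0, hC⟩ := S.exists_Efield_bound
  have hm : Measurable fun p : E3 × E3 => ‖Efield S.f t p.1‖ :=
    ((S.measurable_Efield t).comp measurable_fst).norm
  have := (S.integrable_mul_f ht hψ).bdd_mul (c := C) hm.aestronglyMeasurable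
    (Eventually.of_forall fun p => by simpa using hC t p.1)
  refine this.congr (Eventually.of_forall fun p => ?_)
  simp only []
  ring

/-- The moment `∬ |x-ξ|⁻² f`, which bounds the field at the charge. -/
def chargeMoment (t : ℝ) : ℝ := ∫ p : E3 × E3, (‖p.1 - S.ξ t‖ ^ 2)⁻¹ * S.f t p.1 p.2

/-- The moment `∬ h^{(m-1)/2} |E| f`. -/
def fieldMoment (m t : ℝ) : ℝ :=
  ∫ p : E3 × E3, hEnergy S.f S.ξ S.η t p.1 p.2 ^ ((m - 1) / 2) * ‖Efield S.f t p.1‖ * S.f t p.1 p.2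

theorem chargeMoment_nonneg (t : ℝ) : 0 ≤ S.chargeMoment t :=
  integral_nonneg fun p => mul_nonneg (by positivity) (S.f_nonneg _ _ _)

theorem hEnergy_rpow_nonneg (t : ℝ) (x v : E3) (a : ℝ) : 0 ≤ hEnergy S.f S.ξ S.η t x v ^ a :=
  Real.rpow_nonneg (zero_le_one.trans (S.one_le_hEnergy t x v)) a

theorem fieldMoment_nonneg (m t : ℝ) : 0 ≤ S.fieldMoment m t :=
  integral_nonneg fun _ => mul_nonneg (mul_nonneg (S.hEnergy_rpow_nonneg _ _ _ _) (norm_nonneg _))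
    (S.f_nonneg _ _ _)

theorem Htilde_nonneg (m t : ℝ) : 0 ≤ Htilde S.f S.ξ S.η m t :=
  integral_nonneg fun _ => mul_nonneg (S.hEnergy_rpow_nonneg _ _ _ _) (S.f_nonneg _ _ _)

theorem continuousAt_Fpt {t : ℝ} {x : E3} (hx : x ≠ S.ξ t) : ContinuousAt (Fpt S.ξ t) x := by
  unfold Fpt
  have : ‖x - S.ξ t‖ ^ 3 ≠ 0 := pow_ne_zero 3 (norm_ne_zero_iff.2 (sub_ne_zero.2 hx))
  fun_prop (disch := assumption)

theorem continuousAt_inv_norm_sq {t : ℝ} {p : E3 × E3} (hp : p.1 ≠ S.ξ t) :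
    ContinuousAt (fun p : E3 × E3 => (‖p.1 - S.ξ t‖ ^ 2)⁻¹) p := by
  have : ‖p.1 - S.ξ t‖ ^ 2 ≠ 0 := pow_ne_zero 2 (norm_ne_zero_iff.2 (sub_ne_zero.2 hp))
  fun_prop (disch := assumption)

theorem Efield_charge_eq {t : ℝ} (ht : t ∈ Icc 0 T) :
    Efield S.f t (S.ξ t) = -∫ p : E3 × E3, S.f t p.1 p.2 • Fpt S.ξ t p.1 := by
  have hi := S.integrable_smul_f ht (ψ := fun p => Fpt S.ξ t p.1)
    fun p hp => (S.continuousAt_Fpt hp).comp continuousAt_fst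
  rw [Measure.volume_eq_prod] at hi ⊢
  rw [integral_prod _ hi, ← integral_neg, Efield]
  refine integral_congr_ae (Eventually.of_forall fun y => ?_)
  simp only []
  rw [integral_smul_const, Fpt, ← neg_sub y (S.ξ t), norm_neg, smul_neg, rho, smul_smul,
    div_eq_mul_inv]

theorem norm_Efield_charge_le {t : ℝ} (ht : t ∈ Icc 0 T) :
    ‖Efield S.f t (S.ξ t)‖ ≤ S.chargeMoment t := by
  rw [S.Efield_charge_eq ht, norm_neg, chargeMoment]
  refine (norm_integral_le_integral_norm _).trans (le_of_eq ?_)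
  refine integral_congr_ae (Eventually.of_forall fun p => ?_)
  simp only []
  rw [norm_smul, S.norm_Fpt, Real.norm_of_nonneg (S.f_nonneg _ _ _), mul_comm]

theorem integral_norm_Efield_le {m t : ℝ} (hm : 1 ≤ m) (ht : t ∈ Icc 0 T) :
    ∫ p : E3 × E3, 1 * ‖Efield S.f t p.1‖ * S.f t p.1 p.2 ≤ S.fieldMoment m t := by
  refine integral_mono (S.integrable_mul_Efield ht fun p _ => continuousAt_const)
    (S.integrable_mul_Efield ht fun p hp => S.continuousAt_hEnergy_rpow _ hp) fun p => ?_
  refine mul_le_mul_of_nonneg_right (mul_le_mul_of_nonneg_right ?_ (norm_nonneg _))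
    (S.f_nonneg _ _ _)
  exact Real.one_le_rpow (S.one_le_hEnergy _ _ _) (by linarith)

/-- Differential inequality for the energy moments. -/
theorem exists_hasDerivWithinAt_Htilde {m t : ℝ} (hm : 1 ≤ m) (ht : t ∈ Icc 0 T) :
    ∃ Y', HasDerivWithinAt (Htilde S.f S.ξ S.η m) Y' (Icc 0 T) t ∧
      Y' ≤ m * (S.fieldMoment m t + S.chargeMoment t * Htilde S.f S.ξ S.η m t) := by
  have hpos : ∀ x v, 0 < hEnergy S.f S.ξ S.η t x v := fun x v =>
    zero_lt_one.trans_le (S.one_le_hEnergy t x v)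
  obtain ⟨hi, hd⟩ := S.hasDerivWithinAt_moment
    (φ := fun q => hEnergy S.f S.ξ S.η q.1 q.2.1 q.2.2 ^ (m / 2))
    (fun q hq => S.contDiffAt_hEnergy_rpow _ hq) ht
    (φ' := fun p => inner ℝ (p.2 - S.η t) (Efield S.f t p.1 - Efield S.f t (S.ξ t)) * (m / 2) *
      hEnergy S.f S.ξ S.η t p.1 p.2 ^ (m / 2 - 1)) (fun x v hx => by
        simp only [S.hEnergy_eq]
        have h1 := (S.hasDerivAt_chargeEnergy ht v hx).add_const S.energyShift
        have h2 := h1.rpow_const (p := m / 2) (Or.inl (by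
          simp only [zero_smul, add_zero]
          rw [← S.hEnergy_eq]
          exact (hpos x v).ne'))
        simpa using h2)
  refine ⟨_, hd, ?_⟩
  have i1 := S.integrable_mul_Efield ht (ψ := fun p =>
      hEnergy S.f S.ξ S.η t p.1 p.2 ^ ((m - 1) / 2))
    fun p hp => S.continuousAt_hEnergy_rpow _ hp
  have i2 := S.integrable_mul_f ht (ψ := fun p => hEnergy S.f S.ξ S.η t p.1 p.2 ^ (m / 2))
    fun p hp => S.continuousAt_hEnergy_rpow _ hp
  have hA := S.norm_Efield_charge_le ht
  rw [fieldMoment, Htilde, ← integral_const_mul, ← integral_add i1 (i2.const_mul _),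
    ← integral_const_mul]
  refine integral_mono hi ((i1.add (i2.const_mul _)).const_mul m) fun p => ?_
  have hf := S.f_nonneg t p.1 p.2
  set h := hEnergy S.f S.ξ S.η t p.1 p.2 with hh
  have h1 : 1 ≤ h := S.one_le_hEnergy t p.1 p.2
  have h0 : 0 < h := zero_lt_one.trans_le h1
  have hin : inner ℝ (p.2 - S.η t) (Efield S.f t p.1 - Efield S.f t (S.ξ t)) ≤
      (2 * h ^ (1 / 2 : ℝ)) * (‖Efield S.f t p.1‖ + S.chargeMoment t) := by
    refine (real_inner_le_norm _ _).trans (mul_le_mul ?_ ?_ (norm_nonneg _) (by positivity))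
    · refine (S.norm_sub_η_le t p.1 p.2).trans (mul_le_mul_of_nonneg_right ?_ (by positivity))
      exact Real.sqrt_le_iff.2 ⟨by norm_num, by norm_num⟩
    · exact (norm_sub_le _ _).trans (by linarith)
  have e1 : h ^ (1 / 2 : ℝ) * h ^ (m / 2 - 1) = h ^ ((m - 1) / 2) := by
    rw [← Real.rpow_add h0]; congr 1; ring
  have e2 : h ^ ((m - 1) / 2) ≤ h ^ (m / 2) := Real.rpow_le_rpow_of_exponent_le h1 (by linarith)
  have hA0 := S.chargeMoment_nonneg t
  calc inner ℝ (p.2 - S.η t) (Efield S.f t p.1 - Efield S.f t (S.ξ t)) * (m / 2) *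
        h ^ (m / 2 - 1) * S.f t p.1 p.2
      ≤ (2 * h ^ (1 / 2 : ℝ)) * (‖Efield S.f t p.1‖ + S.chargeMoment t) * (m / 2) *
        h ^ (m / 2 - 1) * S.f t p.1 p.2 := by gcongr
    _ = m * (h ^ ((m - 1) / 2) * ‖Efield S.f t p.1‖ * S.f t p.1 p.2 +
          S.chargeMoment t * (h ^ ((m - 1) / 2) * S.f t p.1 p.2)) := by rw [← e1]; ring
    _ ≤ m * (h ^ ((m - 1) / 2) * ‖Efield S.f t p.1‖ * S.f t p.1 p.2 +
          S.chargeMoment t * (h ^ (m / 2) * S.f t p.1 p.2)) := by gcongr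

/-- The radial momentum relative to the charge. -/
def radialMoment (t : ℝ) : ℝ := ∫ p : E3 × E3,
  (‖p.1 - S.ξ t‖⁻¹ * inner ℝ (p.2 - S.η t) (p.1 - S.ξ t)) * S.f t p.1 p.2

/-- The radial momentum controls the moment `∬ |x-ξ|⁻² f`. -/
theorem exists_hasDerivWithinAt_radialMoment {m t : ℝ} (hm : 1 ≤ m) (ht : t ∈ Icc 0 T) :
    ∃ V', HasDerivWithinAt S.radialMoment V' (Icc 0 T) t ∧
      (1 - mass S.f 0) * S.chargeMoment t - S.fieldMoment m t ≤ V' := by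
  have hne : ∀ {t : ℝ} {x : E3}, x ≠ S.ξ t → ‖x - S.ξ t‖ ≠ 0 := fun hx =>
    norm_ne_zero_iff.2 (sub_ne_zero.2 hx)
  set φ' : E3 × E3 → ℝ := fun p => ‖p.1 - S.ξ t‖⁻¹ *
      inner ℝ (Efield S.f t p.1 - Efield S.f t (S.ξ t)) (p.1 - S.ξ t) +
      (‖p.1 - S.ξ t‖ ^ 2)⁻¹ + (‖p.1 - S.ξ t‖⁻¹ * ‖p.2 - S.η t‖ ^ 2 -
        (‖p.1 - S.ξ t‖ ^ 3)⁻¹ * inner ℝ (p.2 - S.η t) (p.1 - S.ξ t) ^ 2) with hφ'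
  obtain ⟨hi, hd⟩ := S.hasDerivWithinAt_moment
    (φ := fun q => ‖q.2.1 - S.ξ q.1‖⁻¹ * inner ℝ (q.2.2 - S.η q.1) (q.2.1 - S.ξ q.1))
    (fun q hq => by
      refine ContDiffAt.mul ?_ (S.contDiff_sub_η.inner ℝ S.contDiff_sub_ξ).contDiffAt
      exact (S.contDiff_sub_ξ.contDiffAt.norm ℝ (sub_ne_zero.2 hq)).inv (hne hq)) ht
    (φ' := φ') (fun x v hx => by
        have h1 := S.hasDerivAt_sub_η ht v (S.force t x)
        have h2 := S.hasDerivAt_sub_ξ t x v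
        have h3 := (hasDerivAt_norm_of_ne_zero h2
          (by simpa using sub_ne_zero.2 hx)).inv (by simpa using sub_ne_zero.2 hx)
        refine (h3.mul (h1.inner ℝ h2)).congr_deriv ?_
        have hr := hne hx
        have hc := real_inner_comm (x - S.ξ t) (v - S.η t)
        simp only [zero_smul, add_zero, Pi.inv_apply, force, Fpt, hφ', hc]
        simp only [inner_sub_left (_ + _), inner_add_left, inner_smul_left,
          inner_sub_left (Efield S.f t x), real_inner_self_eq_norm_sq, RCLike.conj_to_real]
        field_simp
        ring)
  refine ⟨_, hd, ?_⟩
  have i1 := S.integrable_mul_Efield ht (ψ := fun p => 1) fun p hp => continuousAt_const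
  have i2 := S.integrable_mul_f ht (ψ := fun p => (‖p.1 - S.ξ t‖ ^ 2)⁻¹)
    fun p hp => S.continuousAt_inv_norm_sq hp
  have hA := S.norm_Efield_charge_le ht
  have hA0 := S.chargeMoment_nonneg t
  have hD := S.integral_norm_Efield_le hm ht
  have hM := S.mass_eq ht
  have hM0 := S.mass_nonneg 0
  have key : S.chargeMoment t - ∫ p : E3 × E3, 1 * ‖Efield S.f t p.1‖ * S.f t p.1 p.2 ≤
      (∫ p : E3 × E3, φ' p * S.f t p.1 p.2) + ‖Efield S.f t (S.ξ t)‖ * mass S.f t := by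
    rw [chargeMoment, ← integral_sub i2 i1, mass, ← integral_const_mul,
      ← integral_add hi ((S.integrable_f t).const_mul _)]
    refine integral_mono (i2.sub i1) (hi.add ((S.integrable_f t).const_mul _)) fun p => ?_
    simp only [← sub_mul, ← add_mul]
    refine mul_le_mul_of_nonneg_right ?_ (S.f_nonneg _ _ _)
    have hr : 0 ≤ ‖p.1 - S.ξ t‖ := norm_nonneg _
    have c1 : -(‖Efield S.f t p.1‖ + ‖Efield S.f t (S.ξ t)‖) ≤ ‖p.1 - S.ξ t‖⁻¹ *
        inner ℝ (Efield S.f t p.1 - Efield S.f t (S.ξ t)) (p.1 - S.ξ t) := by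
      rcases hr.eq_or_lt with h | h
      · rw [← h]
        simp only [inv_zero, zero_mul, Left.neg_nonpos_iff]
        positivity
      · have a1 := neg_le_of_abs_le (abs_real_inner_le_norm
          (Efield S.f t p.1 - Efield S.f t (S.ξ t)) (p.1 - S.ξ t))
        have a2 := mul_le_mul_of_nonneg_right
          (norm_sub_le (Efield S.f t p.1) (Efield S.f t (S.ξ t))) h.le
        rw [inv_mul_eq_div, le_div_iff₀ h]
        linarith
    have c2 : (‖p.1 - S.ξ t‖ ^ 3)⁻¹ * inner ℝ (p.2 - S.η t) (p.1 - S.ξ t) ^ 2 ≤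
        ‖p.1 - S.ξ t‖⁻¹ * ‖p.2 - S.η t‖ ^ 2 := by
      rcases hr.eq_or_lt with h | h
      · rw [← h]; simp
      · have a1 := pow_le_pow_left₀ (abs_nonneg _) (abs_real_inner_le_norm
          (p.2 - S.η t) (p.1 - S.ξ t)) 2
        rw [sq_abs] at a1
        rw [inv_mul_eq_div, inv_mul_eq_div, div_le_div_iff₀ (by positivity) h]
        have a2 := mul_le_mul_of_nonneg_right a1 h.le
        nlinarith [a2]
    simp only [hφ']
    linarith
  rw [hM] at key
  have := mul_le_mul_of_nonneg_right hA hM0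
  linarith

end VPClassicalSolution

namespace VPClassicalSolution

variable {T : ℝ} (S : VPClassicalSolution T)

/-- Kinetic energy of the plasma plus its interaction energy with the charge, in the inertial
frame in which the charge is initially at rest. -/
def plasmaEnergy (t : ℝ) : ℝ :=
  ∫ p : E3 × E3, (‖p.2 - S.η 0‖ ^ 2 / 2 + ‖p.1 - S.ξ t‖⁻¹) * S.f t p.1 p.2

theorem continuousAt_inv_norm {t : ℝ} {p : E3 × E3} (hp : p.1 ≠ S.ξ t) :
    ContinuousAt (fun p : E3 × E3 => ‖p.1 - S.ξ t‖⁻¹) p := by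
  have : ‖p.1 - S.ξ t‖ ≠ 0 := norm_ne_zero_iff.2 (sub_ne_zero.2 hp)
  fun_prop (disch := assumption)

theorem plasmaEnergy_nonneg (t : ℝ) : 0 ≤ S.plasmaEnergy t :=
  integral_nonneg fun _ => mul_nonneg (by positivity) (S.f_nonneg _ _ _)

/-- The kinetic and charge interaction energies change only through the self-consistent field. -/
theorem exists_hasDerivWithinAt_plasmaEnergy {m t : ℝ} (hm : 2 ≤ m) (ht : t ∈ Icc 0 T) :
    ∃ P', HasDerivWithinAt (fun s => ‖S.η s - S.η 0‖ ^ 2 / 2 + S.plasmaEnergy s) P' (Icc 0 T) t ∧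
      P' ≤ (2 + ‖S.η t - S.η 0‖) * S.fieldMoment m t := by
  have hne : ∀ {t : ℝ} {x : E3}, x ≠ S.ξ t → ‖x - S.ξ t‖ ≠ 0 := fun hx =>
    norm_ne_zero_iff.2 (sub_ne_zero.2 hx)
  obtain ⟨hi, hd⟩ := S.hasDerivWithinAt_moment
    (φ := fun q => ‖q.2.2 - S.η 0‖ ^ 2 / 2 + ‖q.2.1 - S.ξ q.1‖⁻¹)
    (fun q hq => by
      refine ContDiffAt.add ?_ ?_
      · exact (((contDiff_snd.snd.sub contDiff_const).norm_sq ℝ).div_const 2).contDiffAt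
      · exact (S.contDiff_sub_ξ.contDiffAt.norm ℝ (sub_ne_zero.2 hq)).inv (hne hq)) ht
    (φ' := fun p => inner ℝ (p.2 - S.η 0) (Efield S.f t p.1) +
        inner ℝ (S.η t - S.η 0) (Fpt S.ξ t p.1))
    (fun x v hx => by
        have h1 : HasDerivAt (fun s : ℝ => v + s • S.force t x - S.η 0) (S.force t x) 0 := by
          simpa using (((hasDerivAt_id (0 : ℝ)).smul_const (S.force t x)).const_add v).sub_const
              (S.η 0)
        have h3 := (hasDerivAt_norm_of_ne_zero (S.hasDerivAt_sub_ξ t x v)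
          (by simpa using sub_ne_zero.2 hx)).inv (by simpa using sub_ne_zero.2 hx)
        refine ((h1.norm_sq.div_const 2).add h3).congr_deriv ?_
        have hr := hne hx
        have hc := real_inner_comm (x - S.ξ t) (v - S.η t)
        nth_rw 1 [show v - S.η t = (v - S.η 0) - (S.η t - S.η 0) by abel] at hc
        rw [inner_sub_left] at hc
        simp only [zero_smul, add_zero, force, Fpt, inner_add_right, inner_smul_right, ← hc]
        field_simp
        ring)
  have i1 := S.integrable_smul_f ht (ψ := fun p => Fpt S.ξ t p.1)
    fun p hp => (S.continuousAt_Fpt hp).comp continuousAt_fst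
  have hη : HasDerivWithinAt (fun s => ‖S.η s - S.η 0‖ ^ 2 / 2)
      (inner ℝ (S.η t - S.η 0) (Efield S.f t (S.ξ t))) (Icc 0 T) t := by
    refine HasDerivAt.hasDerivWithinAt
      ((((S.η_ode t ht).sub_const (S.η 0)).norm_sq.div_const 2).congr_deriv ?_)
    ring
  refine ⟨_, hη.add hd, ?_⟩
  have e1 : ∫ p : E3 × E3, inner ℝ (S.η t - S.η 0) (Fpt S.ξ t p.1) * S.f t p.1 p.2 =
      -inner ℝ (S.η t - S.η 0) (Efield S.f t (S.ξ t)) := by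
    rw [S.Efield_charge_eq ht, inner_neg_right, neg_neg, ← integral_inner i1]
    refine integral_congr_ae (Eventually.of_forall fun p => ?_)
    simp only [inner_smul_right]
    ring
  have i2 : Integrable fun p : E3 × E3 => inner ℝ (S.η t - S.η 0) (Fpt S.ξ t p.1) *
      S.f t p.1 p.2 := by
    refine (i1.const_inner (𝕜 := ℝ) (S.η t - S.η 0)).congr (Eventually.of_forall fun p => ?_)
    simp only [inner_smul_right]
    ring
  have i3 : Integrable fun p : E3 × E3 => inner ℝ (p.2 - S.η 0) (Efield S.f t p.1) *
      S.f t p.1 p.2 := by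
    refine (hi.sub i2).congr (Eventually.of_forall fun p => ?_)
    simp only [Pi.sub_apply]
    ring
  have i4 := S.integrable_mul_Efield ht (ψ := fun p =>
      hEnergy S.f S.ξ S.η t p.1 p.2 ^ ((m - 1) / 2))
    fun p hp => S.continuousAt_hEnergy_rpow _ hp
  simp only [add_mul]
  rw [integral_add i3 i2, e1, fieldMoment, ← integral_const_mul, ← integral_const_mul,
    ← integral_add (i4.const_mul _) (i4.const_mul _)]
  rw [add_comm, add_assoc, neg_add_cancel, add_zero]
  refine integral_mono i3 ((i4.const_mul _).add (i4.const_mul _)) fun p => ?_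
  simp only [← mul_assoc, ← add_mul]
  refine mul_le_mul_of_nonneg_right ?_ (S.f_nonneg _ _ _)
  refine (real_inner_le_norm _ _).trans (mul_le_mul_of_nonneg_right ?_ (norm_nonneg _))
  have h1 := S.one_le_hEnergy t p.1 p.2
  have a1 : ‖p.2 - S.η 0‖ ≤ ‖p.2 - S.η t‖ + ‖S.η t - S.η 0‖ := by
    simpa using norm_add_le (p.2 - S.η t) (S.η t - S.η 0)
  have a2 : ‖p.2 - S.η t‖ ≤ 2 * hEnergy S.f S.ξ S.η t p.1 p.2 ^ (1 / 2 : ℝ) :=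
    (S.norm_sub_η_le t p.1 p.2).trans (mul_le_mul_of_nonneg_right
      (Real.sqrt_le_iff.2 ⟨by norm_num, by norm_num⟩) (S.hEnergy_rpow_nonneg _ _ _ _))
  have a3 : hEnergy S.f S.ξ S.η t p.1 p.2 ^ (1 / 2 : ℝ) ≤
      hEnergy S.f S.ξ S.η t p.1 p.2 ^ ((m - 1) / 2) :=
    Real.rpow_le_rpow_of_exponent_le h1 (by linarith)
  have a4 : 1 ≤ hEnergy S.f S.ξ S.η t p.1 p.2 ^ ((m - 1) / 2) :=
    Real.one_le_rpow h1 (by linarith)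
  nlinarith [norm_nonneg (S.η t - S.η 0)]

theorem integrable_plasmaEnergy {t : ℝ} (ht : t ∈ Icc 0 T) : Integrable fun p : E3 × E3 =>
    (‖p.2 - S.η 0‖ ^ 2 / 2 + ‖p.1 - S.ξ t‖⁻¹) * S.f t p.1 p.2 :=
  S.integrable_mul_f ht fun p hp =>
    (by fun_prop : ContinuousAt (fun p : E3 × E3 => ‖p.2 - S.η 0‖ ^ 2 / 2) p).add
      (S.continuousAt_inv_norm hp)

theorem plasmaEnergy_zero_le {m : ℝ} (hm : 2 ≤ m) :
    S.plasmaEnergy 0 ≤ Htilde S.f S.ξ S.η m 0 := by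
  have h0 : (0 : ℝ) ∈ Icc 0 T := ⟨le_rfl, S.T_pos.le⟩
  refine integral_mono (S.integrable_plasmaEnergy h0)
    (S.integrable_mul_f h0 fun p hp => S.continuousAt_hEnergy_rpow (m / 2) hp) fun p => ?_
  refine mul_le_mul_of_nonneg_right ?_ (S.f_nonneg _ _ _)
  have h1 := S.one_le_hEnergy 0 p.1 p.2
  calc ‖p.2 - S.η 0‖ ^ 2 / 2 + ‖p.1 - S.ξ 0‖⁻¹ ≤ hEnergy S.f S.ξ S.η 0 p.1 p.2 := by
        rw [S.hEnergy_eq, chargeEnergy]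
        linarith [S.one_le_energyShift]
    _ = hEnergy S.f S.ξ S.η 0 p.1 p.2 ^ (1 : ℝ) := (Real.rpow_one _).symm
    _ ≤ _ := Real.rpow_le_rpow_of_exponent_le h1 (by linarith)

theorem abs_radialMoment_le {t : ℝ} (ht : t ∈ Icc 0 T) (hM : mass S.f 0 ≤ 1) :
    |S.radialMoment t| ≤ 1 + S.plasmaEnergy t + ‖S.η t - S.η 0‖ := by
  have i1 := S.integrable_plasmaEnergy ht
  have i2 := (S.integrable_f t).const_mul (1 + ‖S.η t - S.η 0‖)
  have hb : |S.radialMoment t| ≤ S.plasmaEnergy t + (1 + ‖S.η t - S.η 0‖) * mass S.f t := by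
    rw [radialMoment, plasmaEnergy, mass, ← integral_const_mul, ← integral_add i1 i2,
      ← Real.norm_eq_abs]
    refine norm_integral_le_of_norm_le (i1.add i2) (Eventually.of_forall fun p => ?_)
    rw [norm_mul, Real.norm_of_nonneg (S.f_nonneg t p.1 p.2)]
    simp only [← add_mul]
    refine mul_le_mul_of_nonneg_right ?_ (S.f_nonneg _ _ _)
    rw [norm_mul, norm_inv, norm_norm, Real.norm_eq_abs]
    have a1 := abs_real_inner_le_norm (p.2 - S.η t) (p.1 - S.ξ t)
    have a2 : ‖p.1 - S.ξ t‖⁻¹ * |inner ℝ (p.2 - S.η t) (p.1 - S.ξ t)| ≤ ‖p.2 - S.η t‖ := by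
      rcases (norm_nonneg (p.1 - S.ξ t)).eq_or_lt with h | h
      · rw [← h]; simp
      · rw [inv_mul_eq_div, div_le_iff₀ h]; exact a1
    have a3 : ‖p.2 - S.η t‖ ≤ ‖p.2 - S.η 0‖ + ‖S.η t - S.η 0‖ := by
      simpa using norm_sub_le (p.2 - S.η 0) (S.η t - S.η 0)
    have a4 : 0 ≤ ‖p.1 - S.ξ t‖⁻¹ := by positivity
    nlinarith [sq_nonneg (‖p.2 - S.η 0‖ - 1)]
  rw [S.mass_eq ht] at hb
  have := mul_le_mul_of_nonneg_left hM (by positivity : 0 ≤ 1 + ‖S.η t - S.η 0‖)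
  linarith

end VPClassicalSolution

/-- Constant in the velocity moment interpolation inequality. -/
def interpConst (Λ : ℝ) : ℝ := 1 + Λ * √2 ^ 3 * (volume (Metric.ball (0 : E3) 1)).toReal

theorem one_le_interpConst {Λ : ℝ} (hΛ : 0 ≤ Λ) : 1 ≤ interpConst Λ := by
  unfold interpConst
  have : 0 ≤ Λ * √2 ^ 3 * (volume (Metric.ball (0 : E3) 1)).toReal := by positivity
  linarith

/-- Interpolation of velocity moments of a bounded density. -/
theorem lintegral_rpow_mul_le_moment {g : E3 → ℝ≥0∞} {h : E3 → ℝ}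
    (h1 : ∀ v, 1 ≤ h v) {u : E3} (hu : ∀ v, ‖v - u‖ ^ 2 / 2 ≤ h v) {Λ : ℝ}
    (hΛ : 0 ≤ Λ) (hgΛ : ∀ v, g v ≤ ENNReal.ofReal Λ) {j m : ℝ} (hj : 0 ≤ j) (hjm : j ≤ m)
    (hm : 0 < m) :
    ∫⁻ v, ENNReal.ofReal (h v ^ (j / 2)) * g v ≤ ENNReal.ofReal (interpConst Λ) *
      (∫⁻ v, ENNReal.ofReal (h v ^ (m / 2)) * g v) ^ ((j + 3) / (m + 3)) := by
  set n := ∫⁻ v, ENNReal.ofReal (h v ^ (m / 2)) * g v with hn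
  have hC := one_le_interpConst hΛ
  have hle : ∫⁻ v, ENNReal.ofReal (h v ^ (j / 2)) * g v ≤ n := by
    refine lintegral_mono fun v => mul_le_mul_left ?_ _
    exact ENNReal.ofReal_le_ofReal (Real.rpow_le_rpow_of_exponent_le (h1 v) (by linarith))
  rcases eq_or_ne n 0 with h0 | h0
  · rw [h0] at hle
    exact hle.trans (zero_le)
  rcases eq_or_ne n ⊤ with htop | htop
  · rw [htop, ENNReal.top_rpow_of_pos (by positivity),
      ENNReal.mul_top (by simpa using zero_lt_one.trans_le hC)]
    exact le_top
  set N := n.toReal with hN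
  have hN0 : 0 < N := ENNReal.toReal_pos h0 htop
  have hnN : n = ENNReal.ofReal N := (ENNReal.ofReal_toReal htop).symm
  set R := N ^ (1 / (m + 3)) with hR
  have hR0 : 0 < R := Real.rpow_pos_of_pos hN0 _
  have hpt : ∀ v, ENNReal.ofReal (h v ^ (j / 2)) * g v ≤
      (Metric.closedBall u (√2 * R)).indicator (fun _ => ENNReal.ofReal (R ^ j * Λ)) v +
        ENNReal.ofReal (R ^ (j - m)) * (ENNReal.ofReal (h v ^ (m / 2)) * g v) := by
    intro v
    have hpos : 0 < h v := zero_lt_one.trans_le (h1 v)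
    by_cases hv : h v ≤ R ^ 2
    · refine le_add_right ?_
      have hmem : v ∈ Metric.closedBall u (√2 * R) := by
        rw [mem_closedBall_iff_norm]
        refine le_of_sq_le_sq ?_ (by positivity)
        rw [mul_pow, Real.sq_sqrt zero_le_two]
        linarith [hu v]
      rw [indicator_of_mem hmem, ENNReal.ofReal_mul (by positivity)]
      refine mul_le_mul' (ENNReal.ofReal_le_ofReal ?_) (hgΛ v)
      calc h v ^ (j / 2) ≤ (R ^ 2) ^ (j / 2) := Real.rpow_le_rpow hpos.le hv (by positivity)
        _ = R ^ j := by
          rw [← Real.rpow_natCast, ← Real.rpow_mul hR0.le]; congr 1; push_cast; ring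
    · refine le_add_left ?_
      rw [← mul_assoc, ← ENNReal.ofReal_mul (by positivity)]
      refine mul_le_mul_left (ENNReal.ofReal_le_ofReal ?_) _
      have e1 : h v ^ (j / 2) = h v ^ ((j - m) / 2) * h v ^ (m / 2) := by
        rw [← Real.rpow_add hpos]; congr 1; ring
      rw [e1]
      refine mul_le_mul_of_nonneg_right ?_ (by positivity)
      calc h v ^ ((j - m) / 2) ≤ (R ^ 2) ^ ((j - m) / 2) :=
            Real.rpow_le_rpow_of_nonpos (by positivity) (not_le.1 hv).le (by linarith)
        _ = R ^ (j - m) := by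
          rw [← Real.rpow_natCast, ← Real.rpow_mul hR0.le]; congr 1; push_cast; ring
  have hvol : volume (Metric.closedBall u (√2 * R)) =
      ENNReal.ofReal ((√2 * R) ^ 3 * (volume (Metric.ball (0 : E3) 1)).toReal) := by
    rw [Measure.addHaar_closedBall _ _ (by positivity), ENNReal.ofReal_mul (by positivity),
      ENNReal.ofReal_toReal measure_ball_lt_top.ne]
    simp
  refine (lintegral_mono hpt).trans ?_
  rw [lintegral_add_left (f := (Metric.closedBall u (√2 * R)).indicator
      (fun _ => ENNReal.ofReal (R ^ j * Λ))) (measurable_const.indicator measurableSet_closedBall),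
    lintegral_indicator_const measurableSet_closedBall,
    lintegral_const_mul' _ _ ENNReal.ofReal_ne_top, ← hn, hvol, hnN,
    ← ENNReal.ofReal_mul (by positivity), ← ENNReal.ofReal_mul (by positivity),
    ENNReal.ofReal_rpow_of_pos hN0, ← ENNReal.ofReal_add (by positivity) (by positivity),
    ← ENNReal.ofReal_mul (by positivity)]
  refine ENNReal.ofReal_le_ofReal (le_of_eq ?_)
  have e2 : R ^ j * R ^ 3 = N ^ ((j + 3) / (m + 3)) := by
    rw [← Real.rpow_natCast, ← Real.rpow_add hR0, hR, ← Real.rpow_mul hN0.le]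
    congr 1; push_cast; ring
  have e3 : R ^ (j - m) * N = N ^ ((j + 3) / (m + 3)) := by
    rw [hR, ← Real.rpow_mul hN0.le, ← Real.rpow_add_one hN0.ne']
    congr 1; field_simp; ring
  rw [e3, ← e2, interpConst]
  ring

namespace VPClassicalSolution

variable {T : ℝ} (S : VPClassicalSolution T)

theorem measurable_hEnergy (t : ℝ) :
    Measurable fun p : E3 × E3 => hEnergy S.f S.ξ S.η t p.1 p.2 := by
  unfold hEnergy
  fun_prop

theorem ofReal_moment {t : ℝ} {ψ : E3 × E3 → ℝ} (hψ : Measurable ψ) (hψ0 : ∀ p, 0 ≤ ψ p)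
    (hi : Integrable fun p : E3 × E3 => ψ p * S.f t p.1 p.2) :
    ENNReal.ofReal (∫ p : E3 × E3, ψ p * S.f t p.1 p.2) =
      ∫⁻ x, ∫⁻ v, ENNReal.ofReal (ψ (x, v)) * ENNReal.ofReal (S.f t x v) := by
  rw [ofReal_integral_eq_lintegral_ofReal hi
    (Eventually.of_forall fun p => mul_nonneg (hψ0 p) (S.f_nonneg _ _ _)), Measure.volume_eq_prod,
    lintegral_prod (fun p => ENNReal.ofReal (ψ p * S.f t p.1 p.2))
      (hψ.mul (S.continuous_f t).measurable).ennreal_ofReal.aemeasurable]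
  exact lintegral_congr fun x => lintegral_congr fun v => ENNReal.ofReal_mul (hψ0 _)

theorem supf0_nonneg : 0 ≤ supf0 S.f := ENNReal.toReal_nonneg

/-- The velocity integral of `h^{k/2} f`. -/
def localMoment (k t : ℝ) (x : E3) : ℝ≥0∞ :=
  ∫⁻ v, ENNReal.ofReal (hEnergy S.f S.ξ S.η t x v ^ (k / 2)) * ENNReal.ofReal (S.f t x v)

theorem measurable_localMoment (k t : ℝ) : Measurable (S.localMoment k t) := by
  refine Measurable.lintegral_prod_right' (f := fun p : E3 × E3 =>
    ENNReal.ofReal (hEnergy S.f S.ξ S.η t p.1 p.2 ^ (k / 2)) * ENNReal.ofReal (S.f t p.1 p.2)) ?_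
  exact ((S.measurable_hEnergy t).pow_const _).ennreal_ofReal.mul
    (S.continuous_f t).measurable.ennreal_ofReal

theorem lintegral_localMoment (k : ℝ) {t : ℝ} (ht : t ∈ Icc 0 T) :
    ∫⁻ x, S.localMoment k t x = ENNReal.ofReal (Htilde S.f S.ξ S.η k t) :=
  (S.ofReal_moment ((S.measurable_hEnergy t).pow_const (k / 2))
    (fun _ => S.hEnergy_rpow_nonneg _ _ _ _)
    (S.integrable_mul_f ht fun _ hp => S.continuousAt_hEnergy_rpow _ hp)).symm

theorem localMoment_le {j m t : ℝ} (hj : 0 ≤ j) (hjm : j ≤ m) (hm : 0 < m) (ht : t ∈ Icc 0 T)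
    (x : E3) : S.localMoment j t x ≤ ENNReal.ofReal (interpConst (supf0 S.f)) *
      S.localMoment m t x ^ ((j + 3) / (m + 3)) := by
  refine lintegral_rpow_mul_le_moment (u := S.η t) (h := fun v => hEnergy S.f S.ξ S.η t x v)
    (fun v => S.one_le_hEnergy t x v) (fun v => ?_) S.supf0_nonneg
    (fun v => ENNReal.ofReal_le_ofReal (S.f_le_supf0 ht x v)) hj hjm hm
  have h1 := S.one_le_energyShift
  have h2 : 0 ≤ ‖x - S.ξ t‖⁻¹ := by positivity
  rw [S.hEnergy_eq, chargeEnergy]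
  linarith

theorem localMoment_zero (t : ℝ) (x : E3) :
    S.localMoment 0 t x = ENNReal.ofReal (rho S.f t x) := by
  rw [S.ofReal_rho, localMoment]
  refine lintegral_congr fun v => ?_
  simp

/-- A power of `localMoment j` is integrable with the sharp homogeneity. -/
theorem lintegral_localMoment_rpow_le {j m t : ℝ} (hj : 0 ≤ j) (hjm : j ≤ m) (hm : 0 < m)
    (ht : t ∈ Icc 0 T) :
    (∫⁻ x, S.localMoment j t x ^ ((m + 3) / (j + 3))) ^ ((j + 3) / (m + 3)) ≤
      ENNReal.ofReal (interpConst (supf0 S.f) *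
        Htilde S.f S.ξ S.η m t ^ ((j + 3) / (m + 3))) := by
  have hC := one_le_interpConst S.supf0_nonneg
  have hC0 : 0 ≤ interpConst (supf0 S.f) := zero_le_one.trans hC
  have hp : 0 < (m + 3) / (j + 3) := by positivity
  have hmul : (j + 3) / (m + 3) * ((m + 3) / (j + 3)) = 1 := by field_simp
  have hmul' : (m + 3) / (j + 3) * ((j + 3) / (m + 3)) = 1 := by field_simp
  have h1 : ∫⁻ x, S.localMoment j t x ^ ((m + 3) / (j + 3)) ≤
      ENNReal.ofReal (interpConst (supf0 S.f)) ^ ((m + 3) / (j + 3)) *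
        ENNReal.ofReal (Htilde S.f S.ξ S.η m t) := by
    rw [← S.lintegral_localMoment m ht, ← lintegral_const_mul' _ _ (by simp [hp.le])]
    refine lintegral_mono fun x => ?_
    refine (ENNReal.rpow_le_rpow (S.localMoment_le hj hjm hm ht x) hp.le).trans (le_of_eq ?_)
    rw [ENNReal.mul_rpow_of_nonneg _ _ hp.le, ← ENNReal.rpow_mul, hmul, ENNReal.rpow_one]
  refine (ENNReal.rpow_le_rpow h1 (by positivity)).trans (le_of_eq ?_)
  rw [ENNReal.mul_rpow_of_nonneg _ _ (by positivity), ← ENNReal.rpow_mul, hmul', ENNReal.rpow_one,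
    ENNReal.ofReal_mul hC0, ENNReal.ofReal_rpow_of_nonneg (S.Htilde_nonneg m t) (by positivity)]

end VPClassicalSolution

open VPClassicalSolution in
/-- The `L^{m+3}` norm of the electric field and the field moment are controlled by the energy
moment of order `m` at the same time. -/
theorem exists_field_estimates {m : ℝ} (hm : 3 < m) (Λ : ℝ) :
    ∃ C : ℝ, 0 ≤ C ∧ ∀ (T : ℝ) (S : VPClassicalSolution T), supf0 S.f = Λ → ∀ t ∈ Icc 0 T,
      (∫⁻ x, ‖Efield S.f t x‖ₑ ^ (m + 3)) ^ (1 / (m + 3)) ≤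
        ENNReal.ofReal (C * (mass S.f 0 + Htilde S.f S.ξ S.η m t ^ (3 / (m + 3)))) ∧
      S.fieldMoment m t ≤ C * (mass S.f 0 + Htilde S.f S.ξ S.η m t ^ (3 / (m + 3))) *
        Htilde S.f S.ξ S.η m t ^ ((m + 2) / (m + 3)) := by
  obtain ⟨CE, hCE0, hCE⟩ := exists_coulomb_rpow_le (q := m + 3) (by linarith)
  refine ⟨CE * interpConst |Λ| * interpConst |Λ|, ?_, ?_⟩
  · have := zero_le_one.trans (one_le_interpConst (abs_nonneg Λ))
    positivity
  intro T S hΛ t ht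
  have hΛ0 : |Λ| = supf0 S.f := by rw [← hΛ, abs_of_nonneg S.supf0_nonneg]
  rw [hΛ0]
  set C1 := interpConst (supf0 S.f) with hC1
  have h1 : 1 ≤ C1 := one_le_interpConst S.supf0_nonneg
  have h0 : 0 ≤ C1 := zero_le_one.trans h1
  set Y := Htilde S.f S.ξ S.η m t with hY
  have hY0 : 0 ≤ Y := S.Htilde_nonneg m t
  have hM0 := S.mass_nonneg 0
  have hE : (∫⁻ x, ‖Efield S.f t x‖ₑ ^ (m + 3)) ^ (1 / (m + 3)) ≤
      ENNReal.ofReal (CE * C1 * (mass S.f 0 + Y ^ (3 / (m + 3)))) := by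
    have a1 := hCE _ (S.measurable_rho t).ennreal_ofReal
    rw [S.lintegral_rho, S.mass_eq ht] at a1
    have a2 := S.lintegral_localMoment_rpow_le (j := 0) (m := m) le_rfl (by linarith)
      (by linarith) ht
    simp only [S.localMoment_zero, zero_add] at a2
    refine (ENNReal.rpow_le_rpow (lintegral_mono fun x =>
      ENNReal.rpow_le_rpow (S.enorm_Efield_le t x) (by positivity)) (by positivity)).trans
      (a1.trans ((mul_le_mul_right (add_le_add_right a2 _) _).trans ?_))
    rw [← ENNReal.ofReal_add hM0 (by positivity), ← ENNReal.ofReal_mul hCE0]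
    refine ENNReal.ofReal_le_ofReal ?_
    rw [mul_assoc]
    refine mul_le_mul_of_nonneg_left ?_ hCE0
    nlinarith
  refine ⟨hE.trans (ENNReal.ofReal_le_ofReal ?_), ?_⟩
  · have : 0 ≤ CE * C1 * (mass S.f 0 + Y ^ (3 / (m + 3))) := by positivity
    nlinarith
  have hD : ENNReal.ofReal (S.fieldMoment m t) =
      ∫⁻ x, ‖Efield S.f t x‖ₑ * S.localMoment (m - 1) t x := by
    rw [fieldMoment, S.ofReal_moment (ψ := fun p =>
      hEnergy S.f S.ξ S.η t p.1 p.2 ^ ((m - 1) / 2) * ‖Efield S.f t p.1‖) ?_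
      (fun p => mul_nonneg (S.hEnergy_rpow_nonneg _ _ _ _) (norm_nonneg _))
      (S.integrable_mul_Efield ht fun p hp => S.continuousAt_hEnergy_rpow _ hp)]
    · refine lintegral_congr fun x => ?_
      rw [localMoment, ← lintegral_const_mul' _ _ enorm_ne_top]
      refine lintegral_congr fun v => ?_
      simp only []
      rw [ENNReal.ofReal_mul (S.hEnergy_rpow_nonneg _ _ _ _), ofReal_norm]
      ring
    · have hm : Measurable fun p : E3 × E3 => ‖Efield S.f t p.1‖ :=
        ((S.measurable_Efield t).comp measurable_fst).norm
      exact ((S.measurable_hEnergy t).pow_const _).mul hm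
  have hconj : (m + 3).HolderConjugate ((m + 3) / (m + 2)) := by
    rw [Real.holderConjugate_iff]
    refine ⟨by linarith, ?_⟩
    field_simp
    ring
  have hH := ENNReal.lintegral_mul_le_Lp_mul_Lq volume hconj
    (f := fun x => ‖Efield S.f t x‖ₑ) (g := S.localMoment (m - 1) t)
    (S.measurable_Efield t).enorm.aemeasurable (S.measurable_localMoment _ _).aemeasurable
  have hL := S.lintegral_localMoment_rpow_le (j := m - 1) (m := m) (by linarith) (by linarith)
    (by linarith) ht
  rw [show m - 1 + 3 = m + 2 by ring] at hL
  rw [one_div_div] at hH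
  have hfin := hD.le.trans (hH.trans (mul_le_mul' hE hL))
  rw [← ENNReal.ofReal_mul (by positivity)] at hfin
  refine ((ENNReal.ofReal_le_ofReal_iff (by positivity)).1 hfin).trans (le_of_eq ?_)
  ring

theorem le_add_mul_of_hasDerivWithinAt_le {g : ℝ → ℝ} {T t c : ℝ} (ht : t ∈ Icc 0 T)
    (hg : ContinuousOn g (Icc 0 T))
    (h : ∀ s ∈ Ico 0 t, ∃ g', HasDerivWithinAt g g' (Icc 0 T) s ∧ g' ≤ c) :
    g t ≤ g 0 + c * t := by
  choose! g' hg' hc using h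
  have key : AntitoneOn (fun s => g s - c * s) (Icc 0 t) := by
    refine antitoneOn_of_hasDerivWithinAt_nonpos (f' := fun s => g' s - c) (convex_Icc 0 t)
      ((hg.mono (Icc_subset_Icc_right ht.2)).sub (by fun_prop)) (fun s hs => ?_) fun s hs => ?_
    all_goals rw [interior_Icc] at hs
    · have h1 := (hg' s (Ioo_subset_Ico_self hs)).mono
        (interior_subset.trans (Icc_subset_Icc_right ht.2) :
        interior (Icc 0 t) ⊆ Icc 0 T)
      have h2 := h1.sub ((hasDerivWithinAt_id s _).const_mul c)
      rw [mul_one] at h2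
      exact h2
    · linarith [hc s (Ioo_subset_Ico_self hs)]
  have := key (left_mem_Icc.2 ht.1) (right_mem_Icc.2 ht.1) ht.1
  simp only [mul_zero, sub_zero] at this
  linarith

theorem forall_lt_zero_of_forall_Ico {G : ℝ → ℝ} {τ : ℝ} (hG : ContinuousOn G (Icc 0 τ))
    (h : ∀ t ∈ Icc 0 τ, (∀ s ∈ Ico 0 t, G s < 0) → G t < 0) : ∀ t ∈ Icc 0 τ, G t < 0 := by
  by_contra! hne
  obtain ⟨t, ht, hGt⟩ := hne
  have hcl : IsCompact (Icc 0 τ ∩ G ⁻¹' Ici 0) :=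
    isCompact_Icc.of_isClosed_subset (hG.preimage_isClosed_of_isClosed isClosed_Icc isClosed_Ici)
      inter_subset_left
  obtain ⟨a, ⟨ha, hGa⟩, hmin⟩ := hcl.exists_isLeast ⟨t, ht, hGt⟩
  refine absurd (h a ha fun s hs => ?_) (not_lt.2 hGa)
  by_contra! hs'
  exact absurd (hmin ⟨⟨hs.1, hs.2.le.trans ha.2⟩, hs'⟩) (not_le.2 hs.2)

set_option maxHeartbeats 1000000 in
/-- A short time, depending only on the mass, the supremum and the energy moment of order `m` of
the initial datum, on which the energy moment of order `m` stays bounded. -/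
theorem exists_forall_Htilde_le {m : ℝ} (hm : 3 < m) (Λ M Y₀ : ℝ) (hM : M < 1) :
    ∃ K τ : ℝ, 0 < τ ∧ ∀ (T : ℝ) (S : VPClassicalSolution T), supf0 S.f = Λ → mass S.f 0 = M →
      Htilde S.f S.ξ S.η m 0 = Y₀ → ∀ t ∈ Icc 0 T, t ≤ τ → Htilde S.f S.ξ S.η m t ≤ K := by
  obtain ⟨C, hC0, hC⟩ := exists_field_estimates hm Λ
  set N := √(2 * (Y₀ + 1)) with hN
  set B := 2 + Y₀ + N with hB
  set κ := m / (1 - M) with hκ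
  set K := Real.exp (κ * B) * (Real.exp (κ * B) * Y₀) + 1 with hK
  set D := C * (M + K ^ (3 / (m + 3))) * K ^ ((m + 2) / (m + 3)) with hD
  set c₁ := Real.exp (κ * B) * ((m + κ * K) * D) with hc₁
  set R := 1 + Real.exp (κ * B) * |c₁| + |(2 + N) * D| with hR
  have hR1 : 0 < R := by positivity
  refine ⟨K, 1 / (2 * R), by positivity, fun T S hΛ hMS hYS => ?_⟩
  have hM0 : 0 ≤ M := hMS ▸ S.mass_nonneg 0
  have hY0 : 0 ≤ Y₀ := hYS ▸ S.Htilde_nonneg m 0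
  have hM1 : 0 < 1 - M := by linarith
  have hκ0 : 0 < κ := by positivity
  have hN0 : 0 ≤ N := Real.sqrt_nonneg _
  have hK0 : 0 < K := by positivity
  have hD0 : 0 ≤ D := by positivity
  have hT : (0 : ℝ) ∈ Icc 0 T := left_mem_Icc.2 S.T_pos.le
  set Y := Htilde S.f S.ξ S.η m with hY
  set P := fun s => ‖S.η s - S.η 0‖ ^ 2 / 2 + S.plasmaEnergy s with hP
  set W := fun s => Y s * Real.exp (-(κ * S.radialMoment s)) with hW
  have hYc : ContinuousOn Y (Icc 0 T) := fun s hs =>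
    (S.exists_hasDerivWithinAt_Htilde (by linarith : 1 ≤ m) hs).choose_spec.1.continuousWithinAt
  have hPc : ContinuousOn P (Icc 0 T) := fun s hs =>
    (S.exists_hasDerivWithinAt_plasmaEnergy (by linarith : 2 ≤ m)
      hs).choose_spec.1.continuousWithinAt
  have hVc : ContinuousOn S.radialMoment (Icc 0 T) := fun s hs =>
    (S.exists_hasDerivWithinAt_radialMoment (by linarith : 1 ≤ m)
      hs).choose_spec.1.continuousWithinAt
  have hWc : ContinuousOn W (Icc 0 T) := hYc.mul (hVc.const_mul κ).neg.rexp
  have hP0 : P 0 ≤ Y₀ := by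
    have := S.plasmaEnergy_zero_le (by linarith : 2 ≤ m)
    rw [← hY, hYS] at this
    simpa [hP] using this
  have hηN : ∀ s, P s ≤ Y₀ + 1 → ‖S.η s - S.η 0‖ ≤ N := fun s hs => by
    refine Real.le_sqrt_of_sq_le ?_
    have := S.plasmaEnergy_nonneg s
    simp only [hP] at hs
    linarith
  have hVB : ∀ s ∈ Icc 0 T, P s ≤ Y₀ + 1 → |S.radialMoment s| ≤ B := fun s hs hPs => by
    have h1 := S.abs_radialMoment_le hs (by linarith)
    have h2 := hηN s hPs
    simp only [hP] at hPs
    nlinarith [sq_nonneg ‖S.η s - S.η 0‖]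
  have hexp : ∀ s ∈ Icc 0 T, P s ≤ Y₀ + 1 →
      Real.exp (-(κ * S.radialMoment s)) ≤ Real.exp (κ * B) ∧
      Real.exp (κ * S.radialMoment s) ≤ Real.exp (κ * B) := fun s hs hPs => by
    have h1 := abs_le.1 (hVB s hs hPs)
    constructor <;> refine Real.exp_le_exp.2 ?_ <;> nlinarith
  have hDs : ∀ s ∈ Icc 0 T, Y s ≤ K → S.fieldMoment m s ≤ D := fun s hs hYs => by
    refine (hC T S hΛ s hs).2.trans ?_
    rw [hMS]
    have := S.Htilde_nonneg m s
    rw [hD]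
    gcongr
  have hPt : ∀ t ∈ Icc 0 T, (∀ s ∈ Ico 0 t, Y s ≤ K ∧ P s ≤ Y₀ + 1) →
      P t ≤ Y₀ + (2 + N) * D * t := fun t ht h => by
    refine (le_add_mul_of_hasDerivWithinAt_le ht hPc fun s hs => ?_).trans
      (add_le_add_left hP0 _)
    have hsT : s ∈ Icc 0 T := ⟨hs.1, hs.2.le.trans ht.2⟩
    obtain ⟨P', h1, h2⟩ := S.exists_hasDerivWithinAt_plasmaEnergy (by linarith : 2 ≤ m) hsT
    refine ⟨P', h1, h2.trans ?_⟩
    have h3 := hDs s hsT (h s hs).1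
    have h4 := hηN s (h s hs).2
    have h5 := S.fieldMoment_nonneg m s
    gcongr
  have hWt : ∀ t ∈ Icc 0 T, (∀ s ∈ Ico 0 t, Y s ≤ K ∧ P s ≤ Y₀ + 1) →
      W t ≤ W 0 + c₁ * t := fun t ht h => by
    refine le_add_mul_of_hasDerivWithinAt_le ht hWc fun s hs => ?_
    have hsT : s ∈ Icc 0 T := ⟨hs.1, hs.2.le.trans ht.2⟩
    obtain ⟨Y', h1, h2⟩ := S.exists_hasDerivWithinAt_Htilde (by linarith : 1 ≤ m) hsT
    obtain ⟨V', h3, h4⟩ := S.exists_hasDerivWithinAt_radialMoment (by linarith : 1 ≤ m) hsT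
    refine ⟨_, h1.mul (h3.const_mul κ).neg.exp, ?_⟩
    have h5 := hDs s hsT (h s hs).1
    have h6 := (h s hs).1
    have h7 := S.fieldMoment_nonneg m s
    have h8 := S.Htilde_nonneg m s
    have h9 := (hexp s hsT (h s hs).2).1
    rw [← hY] at h2 h8
    rw [hMS] at h4
    have hκm : κ * (1 - M) = m := div_mul_cancel₀ _ hM1.ne'
    have hV : m * S.chargeMoment s - κ * S.fieldMoment m s ≤ κ * V' := by
      have := mul_le_mul_of_nonneg_left h4 hκ0.le
      rwa [mul_sub, ← mul_assoc, hκm] at this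
    have hY' : Y' - Y s * (κ * V') ≤ (m + κ * K) * D := by
      calc Y' - Y s * (κ * V')
          ≤ m * (S.fieldMoment m s + S.chargeMoment s * Y s) -
            Y s * (m * S.chargeMoment s - κ * S.fieldMoment m s) := by
              have := mul_le_mul_of_nonneg_left hV h8
              linarith
        _ = (m + κ * Y s) * S.fieldMoment m s := by ring
        _ ≤ (m + κ * K) * D := by gcongr
    simp only [Pi.neg_apply]
    calc _ = Real.exp (-(κ * S.radialMoment s)) * (Y' - Y s * (κ * V')) := by ring
      _ ≤ Real.exp (-(κ * S.radialMoment s)) * ((m + κ * K) * D) := by gcongr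
      _ ≤ c₁ := by rw [hc₁]; gcongr
  have hRτ : ∀ t : ℝ, 0 ≤ t → t ≤ 1 / (2 * R) → ∀ a, a ≤ R → a * t < 1 := fun t h0 h1 a ha => by
    have h2 : R * t ≤ 1 / 2 := by
      calc R * t ≤ R * (1 / (2 * R)) := by gcongr
        _ = 1 / 2 := by field_simp
    nlinarith
  have hmain : ∀ t ∈ Icc 0 (min T (1 / (2 * R))), max (Y t - K) (P t - (Y₀ + 1)) < 0 := by
    have hsub : Icc 0 (min T (1 / (2 * R))) ⊆ Icc 0 T := Icc_subset_Icc_right (min_le_left _ _)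
    refine forall_lt_zero_of_forall_Ico (((hYc.mono hsub).sub continuousOn_const).sup
      ((hPc.mono hsub).sub continuousOn_const)) fun t ht h => ?_
    have hgood : ∀ s ∈ Ico 0 t, Y s ≤ K ∧ P s ≤ Y₀ + 1 := fun s hs => by
      have := max_lt_iff.1 (h s hs)
      constructor <;> linarith
    have htT := hsub ht
    have htR := ht.2.trans (min_le_right _ _)
    have hPt' : P t < Y₀ + 1 := by
      have h1 := hRτ t ht.1 htR ((2 + N) * D) (by
        have := le_abs_self ((2 + N) * D)
        have : 0 ≤ Real.exp (κ * B) * |c₁| := by positivity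
        linarith)
      have := hPt t htT hgood
      linarith
    refine max_lt_iff.2 ⟨?_, by linarith⟩
    have h1 := hRτ t ht.1 htR (Real.exp (κ * B) * c₁) (by
      have h2 : Real.exp (κ * B) * c₁ ≤ Real.exp (κ * B) * |c₁| := by
        gcongr
        exact le_abs_self _
      have := abs_nonneg ((2 + N) * D)
      linarith)
    have h2 := hWt t htT hgood
    have h3 : W 0 ≤ Real.exp (κ * B) * Y₀ := by
      have := (hexp 0 hT (by linarith)).1
      simp only [hW, hYS]
      rw [mul_comm]
      gcongr
    have hWt0 : 0 ≤ W t := mul_nonneg (S.Htilde_nonneg m t) (Real.exp_nonneg _)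
    have h4 : Y t = Real.exp (κ * S.radialMoment t) * W t := by
      simp only [hW]
      rw [mul_left_comm, ← Real.exp_add, add_neg_cancel, Real.exp_zero, mul_one]
    have h5 : Y t ≤ Real.exp (κ * B) * (Real.exp (κ * B) * Y₀ + c₁ * t) := by
      rw [h4]
      have := (hexp t htT hPt'.le).2
      gcongr
      linarith
    rw [hK]
    linarith
  intro t ht htR
  have := max_lt_iff.1 (hmain t ⟨ht.1, le_min ht.2 htR⟩)
  linarith

theorem VPClassicalSolution.Htilde_le_Hmom {T : ℝ} (S : VPClassicalSolution T) {m t : ℝ}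
    (hm : 1 ≤ m) (ht : t ∈ Icc 0 T) : Htilde S.f S.ξ S.η m t ≤ Hmom S.f S.ξ S.η m t := by
  refine le_csSup ?_ (mem_image_of_mem _ (right_mem_Icc.2 ht.1))
  refine (isCompact_Icc.image_of_continuousOn fun s hs => ?_).bddAbove
  exact (S.exists_hasDerivWithinAt_Htilde hm
    (Icc_subset_Icc_right ht.2 hs)).choose_spec.1.continuousWithinAt.mono
      (Icc_subset_Icc_right ht.2)

theorem exists_eLpNorm_Efield_le {m γ δ : ℝ} (hm : 3 < m) (hγ : 0 < γ) (hδ : 0 < δ)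
    (Λ M Y₀ : ℝ) (hM : M < 1) :
    ∃ C : ℝ, ∀ (T : ℝ) (S : VPClassicalSolution T), supf0 S.f = Λ → mass S.f 0 = M →
      Htilde S.f S.ξ S.η m 0 = Y₀ → ∀ t ∈ Icc 0 T,
      eLpNorm (Efield S.f t) (ENNReal.ofReal (m + 3)) volume ≤
        ENNReal.ofReal (C + C * t ^ δ + C * t ^ (1 + γ + δ) *
          Hmom S.f S.ξ S.η m t ^ (3 * ((m + 3) * (1 + γ)) / (m + 3) ^ 2)) := by
  obtain ⟨C, hC0, hC⟩ := exists_field_estimates hm Λ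
  obtain ⟨K, τ, hτ, hK⟩ := exists_forall_Htilde_le hm Λ M Y₀ hM
  refine ⟨C * (|M| + 1 + |K| ^ (3 / (m + 3))) + C * (τ ^ (1 + γ + δ))⁻¹,
    fun T S hΛ hMS hYS t ht => ?_⟩
  have hM0 : 0 ≤ M := hMS ▸ S.mass_nonneg 0
  have hY0 := S.Htilde_nonneg m t
  have hH := S.Htilde_le_Hmom (by linarith : 1 ≤ m) ht
  have hLp : eLpNorm (Efield S.f t) (ENNReal.ofReal (m + 3)) volume =
      (∫⁻ x, ‖Efield S.f t x‖ₑ ^ (m + 3)) ^ (1 / (m + 3)) := by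
    rw [eLpNorm_eq_lintegral_rpow_enorm_toReal (by simp; linarith) ENNReal.ofReal_ne_top,
      ENNReal.toReal_ofReal (by linarith)]
  rw [hLp]
  refine (hC T S hΛ t ht).1.trans (ENNReal.ofReal_le_ofReal ?_)
  rw [hMS, abs_of_nonneg hM0]
  set Y := Htilde S.f S.ξ S.η m t with hY
  set H := Hmom S.f S.ξ S.η m t with hHdef
  have hH0 : 0 ≤ H := hY0.trans hH
  have ht0 : 0 ≤ t := ht.1
  have hexp : H ^ (3 * ((m + 3) * (1 + γ)) / (m + 3) ^ 2) = (H ^ (3 / (m + 3))) ^ (1 + γ) := by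
    rw [← Real.rpow_mul hH0]
    congr 1
    field_simp
  rw [hexp]
  set a := H ^ (3 / (m + 3)) with ha
  have ha0 : 0 ≤ a := by positivity
  set C' := C * (M + 1 + |K| ^ (3 / (m + 3))) + C * (τ ^ (1 + γ + δ))⁻¹ with hC'
  have hC'0 : 0 ≤ C' := by positivity
  have h1 : 0 ≤ C' * t ^ δ := by positivity
  have h2 : 0 ≤ C * (τ ^ (1 + γ + δ))⁻¹ := by positivity
  have h3 : 0 ≤ C * |K| ^ (3 / (m + 3)) := by positivity
  rcases le_or_gt t τ with htτ | htτ
  · have h4 : C * Y ^ (3 / (m + 3)) ≤ C * |K| ^ (3 / (m + 3)) := by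
      gcongr
      exact (hK T S hΛ hMS hYS t ht htτ).trans (le_abs_self K)
    have h5 : 0 ≤ C' * t ^ (1 + γ + δ) * a ^ (1 + γ) := by positivity
    linarith
  · have h4 : Y ^ (3 / (m + 3)) ≤ a := by rw [ha]; gcongr
    have h5 : a ≤ 1 + a ^ (1 + γ) := by
      rcases le_total a 1 with h | h
      · have : 0 ≤ a ^ (1 + γ) := by positivity
        linarith
      · have := Real.rpow_le_rpow_of_exponent_le h (by linarith : 1 ≤ 1 + γ)
        rw [Real.rpow_one] at this
        linarith
    have h6 : 1 ≤ (τ ^ (1 + γ + δ))⁻¹ * t ^ (1 + γ + δ) := by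
      rw [inv_mul_eq_div, one_le_div (by positivity)]
      gcongr
    have h7 : C * a ^ (1 + γ) ≤ C' * t ^ (1 + γ + δ) * a ^ (1 + γ) := by
      refine mul_le_mul_of_nonneg_right ?_ (by positivity)
      calc C ≤ C * ((τ ^ (1 + γ + δ))⁻¹ * t ^ (1 + γ + δ)) := le_mul_of_one_le_right hC0 h6
        _ = C * (τ ^ (1 + γ + δ))⁻¹ * t ^ (1 + γ + δ) := by ring
        _ ≤ C' * t ^ (1 + γ + δ) := by
          gcongr
          rw [hC']
          have : 0 ≤ C * (M + 1 + |K| ^ (3 / (m + 3))) := by positivity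
          linarith
    have h8 : C * Y ^ (3 / (m + 3)) ≤ C * (1 + a ^ (1 + γ)) := by
      gcongr
      exact h4.trans h5
    linarith

/-- Intermediate small time estimate for `‖E(t)‖_{L^{m+3}}`. -/
theorem statement_16 :
    ∃ C : ℝ → ℝ → ℝ → ℝ → ℝ → ℝ → ℝ → ℝ → (ℝ → ℝ) → ℝ,
      ∀ (T : ℝ) (S : VPClassicalSolution T), mass S.f 0 < 1 →
      ∀ m₀ : ℝ, ∀ t ∈ Icc (0 : ℝ) (min 1 T), ∀ m : ℝ, 3 < m → m < m₀ →
      ∀ γ : ℝ, 0 < γ → γ < 1 → γ < (m₀ - m) / (m + 3) →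
        (m < 6 → γ ≤ (m - 3) / (6 - m)) →
        eLpNorm (Efield S.f t) (ENNReal.ofReal (m + 3)) volume
          ≤ ENNReal.ofReal
              (C γ m m₀ (energy S.f S.ξ S.η 0) (mass S.f 0) (1 - mass S.f 0)⁻¹
                  (supf0 S.f) (mass S.f 0)
                  (fun k => if k < m₀ then Htilde S.f S.ξ S.η k 0 else 0)
                + C γ m m₀ (energy S.f S.ξ S.η 0) (mass S.f 0) (1 - mass S.f 0)⁻¹
                    (supf0 S.f) (mass S.f 0)
                    (fun k => if k < m₀ then Htilde S.f S.ξ S.η k 0 else 0)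
                  * t ^ (γ / (1 + (m + 3) * (γ + 1)))
                + C γ m m₀ (energy S.f S.ξ S.η 0) (mass S.f 0) (1 - mass S.f 0)⁻¹
                    (supf0 S.f) (mass S.f 0)
                    (fun k => if k < m₀ then Htilde S.f S.ξ S.η k 0 else 0)
                  * t ^ (1 + γ + γ / (1 + (m + 3) * (γ + 1)))
                  * Hmom S.f S.ξ S.η m t ^ (3 * ((m + 3) * (1 + γ)) / (m + 3) ^ 2)) := by
  choose! C hC using fun (m γ δ : ℝ) (hm : 3 < m) (hγ : 0 < γ) (hδ : 0 < δ) =>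
    exists_eLpNorm_Efield_le hm hγ hδ
  refine ⟨fun γ m _ _ M _ Λ _ g => C m γ (γ / (1 + (m + 3) * (γ + 1))) Λ M (g m),
    fun T S hM m₀ t ht m hm hmm₀ γ hγ _ _ _ => ?_⟩
  exact hC m γ _ hm hγ (by positivity) _ _ _ hM T S rfl rfl (if_pos hmm₀).symm t
    (Icc_subset_Icc_right (min_le_right _ _) ht)

end
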